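/- Let K ⊆ Γ be a set which is both a Kronecker set and a Carleson set. Then the closed ideal J₀⁺(K) of A⁺ has trivial inner factor (S_{J₀⁺(K)} = 1), and the closed ideal generated by J₀⁺(K) in A(Γ) consists of all functions of A(Γ) vanishing on K. -/

import Mathlib

noncomputable section

/-- An invertible contraction on a (complex) Banach space. -/
structure BanachContraction where
  X : Type
  [grp : NormedAddCommGroup X]
  [mod : NormedSpace ℂ X]
  [cpl : CompleteSpace X]
  T : X →L[ℂ] X
  Tinv : X →L[ℂ] X
  norm_le : ‖T‖ ≤ 1
  mul_inv : T * Tinv = 1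
  inv_mul : Tinv * T = 1

attribute [instance] BanachContraction.grp BanachContraction.mod BanachContraction.cpl

open Complex MeasureTheory Metric Set Filter

/-- The `n`-th Taylor coefficient of `f` at `0`, i.e. `f⁽ⁿ⁾(0)/n!`. -/
def taylorCoeff (f : ℂ → ℂ) (n : ℕ) : ℂ := iteratedDeriv n f 0 / (n.factorial : ℂ)

/-- `A⁺`, the algebra of absolutely convergent Taylor series: functions which, on the
closed unit disk, are sums of a power series with absolutely summable coefficients. -/
def APlus : Set (ℂ → ℂ) :=
  {f | ∃ a : ℕ → ℂ, Summable (fun n => ‖a n‖) ∧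
    ∀ z ∈ Metric.closedBall (0 : ℂ) 1, HasSum (fun n => a n * z ^ n) (f z)}

/-- The norm `‖f‖₁ = ∑ₙ |f⁽ⁿ⁾(0)/n!|` on `A⁺`. -/
def APlusNorm (f : ℂ → ℂ) : ℝ := ∑' n : ℕ, ‖taylorCoeff f n‖

/-- The `n`-th Fourier coefficient of (the boundary values of) `f` on the unit circle. -/
def fcoeff (f : ℂ → ℂ) (n : ℤ) : ℂ :=
  (1 / (2 * Real.pi)) * ∫ θ in (0:ℝ)..(2 * Real.pi),
    f (Complex.exp ((θ : ℂ) * Complex.I)) * Complex.exp (-(n : ℂ) * (θ : ℂ) * Complex.I)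

/-- The Wiener algebra `A(Γ)` of absolutely convergent Fourier series on the unit circle,
viewed as functions `ℂ → ℂ` (only the values on the unit circle are relevant). -/
def WienerAlg : Set (ℂ → ℂ) :=
  {f | Summable (fun n : ℤ => ‖fcoeff f n‖) ∧
    ∀ z ∈ Metric.sphere (0 : ℂ) 1, HasSum (fun n : ℤ => fcoeff f n * z ^ n) (f z)}

/-- The norm `‖f‖₁ = ∑_{n ∈ ℤ} |f̂(n)|` on `A(Γ)`. -/
def WienerNorm (f : ℂ → ℂ) : ℝ := ∑' n : ℤ, ‖fcoeff f n‖

/-- `I` is a closed ideal of `A⁺` (closedness w.r.t. the norm `APlusNorm`). -/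
def IsClosedIdealAPlus (I : Set (ℂ → ℂ)) : Prop :=
  I ⊆ APlus ∧
  (∀ f ∈ I, ∀ g ∈ I, f + g ∈ I) ∧
  (∀ f ∈ APlus, ∀ g ∈ I, f * g ∈ I) ∧
  (∀ f ∈ APlus, (∀ ε > 0, ∃ g ∈ I, APlusNorm (f - g) < ε) → f ∈ I)

/-- `J` is a closed ideal of the Wiener algebra `A(Γ)`. -/
def IsClosedIdealW (J : Set (ℂ → ℂ)) : Prop :=
  J ⊆ WienerAlg ∧
  (∀ f ∈ J, ∀ g ∈ J, f + g ∈ J) ∧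
  (∀ f ∈ WienerAlg, ∀ g ∈ J, f * g ∈ J) ∧
  (∀ f ∈ WienerAlg, (∀ ε > 0, ∃ g ∈ J, WienerNorm (f - g) < ε) → f ∈ J)

/-- `I^A` : the closed ideal generated by `I` in the Wiener algebra `A(Γ)`. -/
def IdealGenW (I : Set (ℂ → ℂ)) : Set (ℂ → ℂ) := ⋂₀ {J | IsClosedIdealW J ∧ I ⊆ J}

/-- The hull `h(I)`: common zeros in the closed unit disk of all elements of `I`. -/
def hull (I : Set (ℂ → ℂ)) : Set ℂ :=
  {z ∈ Metric.closedBall (0 : ℂ) 1 | ∀ f ∈ I, f z = 0}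

/-- `I ≠ {0}`: `I` contains an element not identically zero on the unit disk. -/
def NontrivialIdeal (I : Set (ℂ → ℂ)) : Prop :=
  ∃ f ∈ I, ∃ z ∈ Metric.ball (0 : ℂ) 1, f z ≠ 0

/-- `H^∞(D)`: bounded holomorphic functions on the open unit disk. -/
def Hinf : Set (ℂ → ℂ) :=
  {f | DifferentiableOn ℂ f (Metric.ball (0 : ℂ) 1) ∧
    ∃ C : ℝ, ∀ z ∈ Metric.ball (0 : ℂ) 1, ‖f z‖ ≤ C}

/-- An inner function: a bounded-by-one holomorphic function on the unit disk whose
radial limits have modulus `1` at almost every boundary point. -/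
def IsInnerFunction (u : ℂ → ℂ) : Prop :=
  DifferentiableOn ℂ u (Metric.ball (0 : ℂ) 1) ∧
  (∀ z ∈ Metric.ball (0 : ℂ) 1, ‖u z‖ ≤ 1) ∧
  ∀ᵐ (θ : ℝ) ∂(MeasureTheory.volume.restrict (Set.Ioc (0 : ℝ) (2 * Real.pi))),
    Filter.Tendsto (fun r : ℝ => ‖u ((r : ℂ) * Complex.exp ((θ : ℂ) * Complex.I))‖)
      (nhdsWithin 1 (Set.Iio 1)) (nhds 1)

/-- `S` divides (the inner factor of) `f`, i.e. `f ∈ S·H^∞`. -/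
def InnerDivides (S f : ℂ → ℂ) : Prop :=
  ∃ g ∈ Hinf, ∀ z ∈ Metric.ball (0 : ℂ) 1, f z = S z * g z

/-- `S` is a greatest common divisor of the inner factors of the nonzero elements of `I`:
`S` is inner, divides every nonzero element of `I`, and every inner function with this
property divides `S`. -/
def IsGcdInner (I : Set (ℂ → ℂ)) (S : ℂ → ℂ) : Prop :=
  IsInnerFunction S ∧
  (∀ f ∈ I, (∃ z ∈ Metric.ball (0 : ℂ) 1, f z ≠ 0) → InnerDivides S f) ∧
  ∀ S' : ℂ → ℂ, IsInnerFunction S' →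
    (∀ f ∈ I, (∃ z ∈ Metric.ball (0 : ℂ) 1, f z ≠ 0) → InnerDivides S' f) →
    InnerDivides S' S

/-- The perfect symmetric set `E_ξ` of constant ratio `ξ` on the unit circle. -/
def Eset (ξ : ℝ) : Set ℂ :=
  {z | ∃ ε : ℕ → ℕ, (∀ k, ε k ≤ 1) ∧
    z = Complex.exp (2 * Real.pi * Complex.I *
      (((1 - ξ) * ∑' k : ℕ, (ε k : ℝ) * ξ ^ k : ℝ) : ℂ))}

/-- A Carleson set: a closed subset of the unit circle with
`∫_{-π}^{π} log (2 / dist(e^{iθ}, E)) dθ < ∞`. -/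
def IsCarleson (E : Set ℂ) : Prop :=
  IsClosed E ∧ E ⊆ Metric.sphere (0 : ℂ) 1 ∧
  MeasureTheory.IntegrableOn
    (fun θ : ℝ => Real.log (2 / Metric.infDist (Complex.exp ((θ : ℂ) * Complex.I)) E))
    (Set.Ioc (-Real.pi) Real.pi)

/-- The division ideal `I(f) = {g ∈ A⁺ : fg ∈ I}`. -/
def Idiv (I : Set (ℂ → ℂ)) (f : ℂ → ℂ) : Set (ℂ → ℂ) := {g ∈ APlus | f * g ∈ I}

/-- `f` belongs to `A^∞(D)` and vanishes on `E` together with all its derivatives: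
`f` is holomorphic on the disk, and each derivative extends continuously to the closed
disk with the extension vanishing on `E`. -/
def VanishAllDeriv (E : Set ℂ) (f : ℂ → ℂ) : Prop :=
  ContinuousOn f (Metric.closedBall (0 : ℂ) 1) ∧
  DifferentiableOn ℂ f (Metric.ball (0 : ℂ) 1) ∧
  (∀ z ∈ E, f z = 0) ∧
  ∀ n : ℕ, ∃ g : ℂ → ℂ, ContinuousOn g (Metric.closedBall (0 : ℂ) 1) ∧
    Set.EqOn g (iteratedDeriv n f) (Metric.ball (0 : ℂ) 1) ∧ ∀ z ∈ E, g z = 0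

/-- `J₀⁺(E)`: the closure in `A⁺` of the set of elements of `A^∞(D)` vanishing on `E`
together with all their derivatives. -/
def J0Plus (E : Set ℂ) : Set (ℂ → ℂ) :=
  {f | f ∈ APlus ∧ ∀ ε > 0, ∃ g ∈ APlus, VanishAllDeriv E g ∧ APlusNorm (f - g) < ε}

/-- `I⁺(E) = {f ∈ A⁺ : f ≡ 0 on E}`. -/
def IPlus (E : Set ℂ) : Set (ℂ → ℂ) := {f ∈ APlus | ∀ z ∈ E, f z = 0}

/-- The pairing of `f ∈ A⁺ ≅ ℓ¹(ℕ)` with an element `c ∈ c₀`. -/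
def pairing (f : ℂ → ℂ) (c : ℕ → ℂ) : ℂ := ∑' n : ℕ, taylorCoeff f n * c n

/-- `S` is dense in `A⁺` for the weak-star topology `σ(ℓ¹, c₀)`. -/
def WStarDense (S : Set (ℂ → ℂ)) : Prop :=
  ∀ f ∈ APlus, ∀ (m : ℕ) (c : Fin m → ℕ → ℂ),
    (∀ i, Filter.Tendsto (c i) Filter.atTop (nhds 0)) →
    ∀ ε > 0, ∃ g ∈ S, ∀ i, ‖pairing f (c i) - pairing g (c i)‖ < ε

/-- `S` is closed in `A⁺` for the weak-star topology `σ(ℓ¹, c₀)`. -/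
def WStarClosed (S : Set (ℂ → ℂ)) : Prop :=
  S ⊆ APlus ∧
  ∀ f ∈ APlus,
    (∀ (m : ℕ) (c : Fin m → ℕ → ℂ),
      (∀ i, Filter.Tendsto (c i) Filter.atTop (nhds 0)) →
      ∀ ε > 0, ∃ g ∈ S, ∀ i, ‖pairing f (c i) - pairing g (c i)‖ < ε) → f ∈ S

/-- A Kronecker set: a compact subset of the unit circle on which every continuous
unimodular function is a uniform limit of characters `z ↦ zⁿ`, `n ∈ ℤ`. -/
def IsKronecker (K : Set ℂ) : Prop :=
  IsCompact K ∧ K ⊆ Metric.sphere (0 : ℂ) 1 ∧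
  ∀ f : ℂ → ℂ, ContinuousOn f K → (∀ z ∈ K, ‖f z‖ = 1) →
    ∀ ε > 0, ∃ n : ℤ, ∀ z ∈ K, ‖f z - z ^ n‖ < ε

/-- A Helson set: a compact subset of the unit circle on which every continuous function
is the restriction of an element of the Wiener algebra. -/
def IsHelson (K : Set ℂ) : Prop :=
  IsCompact K ∧ K ⊆ Metric.sphere (0 : ℂ) 1 ∧
  ∀ f : ℂ → ℂ, ContinuousOn f K → ∃ g ∈ WienerAlg, ∀ z ∈ K, f z = g z

/-- The little Lipschitz class `Λ_α(D)`: disc-algebra functions with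
`|f(e^{it₁}) - f(e^{it₂})| / |t₁-t₂|^α → 0` uniformly as `|t₁-t₂| → 0`. -/
def LittleLip (α : ℝ) (f : ℂ → ℂ) : Prop :=
  ContinuousOn f (Metric.closedBall (0 : ℂ) 1) ∧
  DifferentiableOn ℂ f (Metric.ball (0 : ℂ) 1) ∧
  ∀ ε > 0, ∃ δ > 0, ∀ t₁ t₂ : ℝ, t₁ ≠ t₂ → |t₁ - t₂| < δ →
    ‖f (Complex.exp ((t₁ : ℂ) * Complex.I)) - f (Complex.exp ((t₂ : ℂ) * Complex.I))‖ ≤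
      ε * |t₁ - t₂| ^ α

/-- The perfect part of a set: the union of all its perfect subsets. -/
def perfectPart (C : Set ℂ) : Set ℂ := ⋃₀ {P | Perfect P ∧ P ⊆ C}

/-- A distribution on the unit circle, encoded by its sequence of Fourier coefficients
`μ̂(n) = μ(e^{-int})`, which has polynomial growth. -/
structure CircleDistribution where
  coeff : ℤ → ℂ
  growth : ∃ (C : ℝ) (k : ℕ), ∀ n : ℤ, ‖coeff n‖ ≤ C * (1 + (n.natAbs : ℝ)) ^ k

/-- A smooth `2π`-periodic function (test function on the circle). -/
def PeriodicSmooth (φ : ℝ → ℂ) : Prop :=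
  ContDiff ℝ (⊤ : ℕ∞) φ ∧ ∀ θ : ℝ, φ (θ + 2 * Real.pi) = φ θ

/-- Fourier coefficients of a test function. -/
def testCoeff (φ : ℝ → ℂ) (n : ℤ) : ℂ :=
  (1 / (2 * Real.pi)) * ∫ θ in (0:ℝ)..(2 * Real.pi),
    φ θ * Complex.exp (-(n : ℂ) * (θ : ℂ) * Complex.I)

/-- The action of a distribution on a test function: `μ(φ) = ∑ₙ μ̂(n) φ̂(-n)`. -/
def distAct (μ : CircleDistribution) (φ : ℝ → ℂ) : ℂ := ∑' n : ℤ, μ.coeff n * testCoeff φ (-n)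

/-- The support of a distribution on the circle: the points of the circle having no open
neighbourhood `U` such that `μ` kills every test function supported in `U`. -/
def distSupport (μ : CircleDistribution) : Set ℂ :=
  {z ∈ Metric.sphere (0 : ℂ) 1 | ∀ U : Set ℂ, IsOpen U → z ∈ U →
    ∃ φ : ℝ → ℂ, PeriodicSmooth φ ∧
      (∀ θ : ℝ, Complex.exp ((θ : ℂ) * Complex.I) ∉ U → φ θ = 0) ∧ distAct μ φ ≠ 0}

/-- A set of multiplicity: a closed subset of the circle supporting a nonzero
pseudofunction (distribution whose Fourier coefficients tend to `0` as `|n| → ∞`). -/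
def IsMSet (E : Set ℂ) : Prop :=
  IsClosed E ∧ E ⊆ Metric.sphere (0 : ℂ) 1 ∧
  ∃ μ : CircleDistribution, μ.coeff ≠ 0 ∧ distSupport μ ⊆ E ∧
    Filter.Tendsto μ.coeff Filter.cofinite (nhds 0)

/-- A Dirichlet set: `sup_{z ∈ E} |z^{n_k} - 1| → 0` for some sequence `n_k → ∞`. -/
def IsDirichletSet (E : Set ℂ) : Prop :=
  ∃ n : ℕ → ℕ, Filter.Tendsto n Filter.atTop Filter.atTop ∧
    ∀ ε > 0, ∀ᶠ k in Filter.atTop, ∀ z ∈ E, ‖z ^ (n k) - 1‖ < ε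

section BanachAlgebra

/-- If the powers of `x` are geometrically bounded then so is the inverse of `1 - x`. -/
theorem norm_le_of_one_sub_mul_eq_one {R : Type*} [NormedRing R] {x r : R} {C q : ℝ}
    (hr : (1 - x) * r = 1) (hx : ∀ k : ℕ, ‖x ^ k‖ ≤ C * q ^ k) (hq0 : 0 ≤ q) (hq1 : q < 1) :
    ‖r‖ ≤ C / (1 - q) := by
  have hC : 0 ≤ C := by simpa using (norm_nonneg _).trans (hx 0)
  have key : ∀ N : ℕ, ‖r‖ ≤ C * q ^ N * ‖r‖ + C / (1 - q) := by
    intro N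
    have h1 : r = x ^ N * r + ∑ k ∈ Finset.range N, x ^ k := by
      have h := geom_sum_mul_neg x N
      have h2 : (∑ k ∈ Finset.range N, x ^ k) * (1 - x) * r = (1 - x ^ N) * r := by rw [h]
      rw [mul_assoc, hr, mul_one, sub_mul, one_mul] at h2
      rw [h2]; abel
    have h3 : ‖∑ k ∈ Finset.range N, x ^ k‖ ≤ C / (1 - q) := by
      calc ‖∑ k ∈ Finset.range N, x ^ k‖ ≤ ∑ k ∈ Finset.range N, C * q ^ k :=
            norm_sum_le_of_le _ fun k _ => hx k
        _ = C * ∑ k ∈ Finset.range N, q ^ k := by rw [Finset.mul_sum]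
        _ ≤ C * (1 - q)⁻¹ := by
            gcongr
            rw [← tsum_geometric_of_lt_one hq0 hq1]
            exact (summable_geometric_of_lt_one hq0 hq1).sum_le_tsum _
              fun k _ => pow_nonneg hq0 k
        _ = C / (1 - q) := rfl
    calc ‖r‖ = ‖x ^ N * r + ∑ k ∈ Finset.range N, x ^ k‖ := by rw [← h1]
      _ ≤ ‖x ^ N * r‖ + ‖∑ k ∈ Finset.range N, x ^ k‖ := norm_add_le _ _
      _ ≤ ‖x ^ N‖ * ‖r‖ + C / (1 - q) := add_le_add (norm_mul_le _ _) h3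
      _ ≤ _ := by gcongr; exact hx N
  have hlim : Tendsto (fun N : ℕ => C * q ^ N * ‖r‖ + C / (1 - q)) atTop
      (nhds (C * 0 * ‖r‖ + C / (1 - q))) :=
    (((tendsto_pow_atTop_nhds_zero_of_lt_one hq0 hq1).const_mul C).mul_const _).add_const _
  have := ge_of_tendsto' hlim key
  simpa using this

variable {B : Type*} [NormedCommRing B] [NormedAlgebra ℂ B]

theorem norm_inverse_sub_le (u : Bˣ) {C : ℝ} (hC1 : 1 ≤ C)
    (hC : ∀ k : ℤ, ‖((u ^ k : Bˣ) : B)‖ ≤ C) {l : ℂ} (hl : ‖l‖ ≠ 1) {r : B}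
    (hr : (algebraMap ℂ B l - u) * r = 1) : ‖r‖ ≤ C ^ 2 / |‖l‖ - 1| := by
  rcases lt_or_gt_of_ne hl with h | h
  · have h1 : ‖(-((u : B) * r))‖ ≤ C / (1 - ‖l‖) := by
      refine norm_le_of_one_sub_mul_eq_one (x := l • ((u⁻¹ : Bˣ) : B)) ?_ ?_ (norm_nonneg _) h
      · rw [Algebra.smul_def]
        linear_combination hr + algebraMap ℂ B l * r * (Units.inv_mul u)
      · intro k
        rw [smul_pow, norm_smul, norm_pow, mul_comm C]
        have := hC (-k : ℤ)
        gcongr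
        simpa using this
    have h2 : r = -(((u⁻¹ : Bˣ) : B) * (-((u : B) * r))) := by
      rw [mul_neg, neg_neg, ← mul_assoc, Units.inv_mul, one_mul]
    have h3 : ‖((u⁻¹ : Bˣ) : B)‖ ≤ C := by simpa using hC (-1)
    rw [h2, norm_neg, abs_of_neg (by linarith), neg_sub]
    calc _ ≤ ‖((u⁻¹ : Bˣ) : B)‖ * ‖(-((u : B) * r))‖ := norm_mul_le _ _
      _ ≤ C * (C / (1 - ‖l‖)) := by gcongr
      _ = _ := by ring
  · have hl0 : l ≠ 0 := by rintro rfl; simp at h; linarith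
    have hlp : 0 < ‖l‖ := norm_pos_iff.2 hl0
    have h1 : ‖l • r‖ ≤ C / (1 - ‖l‖⁻¹) := by
      refine norm_le_of_one_sub_mul_eq_one (x := l⁻¹ • (u : B)) ?_ ?_ (by positivity)
        (inv_lt_one_of_one_lt₀ h)
      · have h2 : algebraMap ℂ B l⁻¹ * algebraMap ℂ B l = 1 := by
          rw [← map_mul, inv_mul_cancel₀ hl0, map_one]
        rw [Algebra.smul_def, Algebra.smul_def]
        linear_combination hr - (u : B) * r * h2
      · intro k
        rw [smul_pow, norm_smul, norm_pow, mul_comm C, norm_inv]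
        have := hC k
        gcongr
        simpa using this
    rw [norm_smul] at h1
    rw [abs_of_pos (by linarith), le_div_iff₀ (by linarith)]
    rw [le_div_iff₀ (by simp [inv_lt_one_of_one_lt₀ h])] at h1
    have h4 : ‖l‖ * ‖r‖ * (1 - ‖l‖⁻¹) = ‖r‖ * (‖l‖ - 1) := by field_simp
    rw [h4] at h1
    nlinarith

variable [CompleteSpace B]

open WeakDual in
theorem isUnit_of_forall_character {a : B} (h : ∀ χ : characterSpace ℂ B, χ a ≠ 0) :
    IsUnit a := by
  by_contra ha
  obtain ⟨χ, hχ⟩ := WeakDual.CharacterSpace.exists_apply_eq_zero ha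
  exact h χ hχ

open WeakDual in
/-- A doubly power-bounded element whose spectrum is close to `1` is close to `1`. -/
theorem norm_sub_one_le_of_character (u : Bˣ) {C ρ : ℝ} (hC1 : 1 ≤ C)
    (hC : ∀ k : ℤ, ‖((u ^ k : Bˣ) : B)‖ ≤ C) (hρ0 : 0 < ρ) (hρ1 : ρ ≤ 1)
    (hsp : ∀ χ : characterSpace ℂ B, ‖χ (u : B) - 1‖ < ρ) :
    ‖(u : B) - 1‖ ≤ 4 * C ^ 2 * ρ := by
  set x : B := (u : B) - 1 with hx
  have hunit : ∀ w : ℂ, ‖w‖ ≤ 1 / ρ → IsUnit (1 - w • x) := by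
    intro w hw
    refine isUnit_of_forall_character fun χ h0 => ?_
    have h1 : w * (χ (u : B) - 1) = 1 := by
      have : χ (1 - w • x) = 1 - w * (χ (u : B) - 1) := by
        simp [hx, map_sub, map_smul]
      rw [this] at h0
      linear_combination -h0
    have h2 := congrArg norm h1
    rw [norm_mul, norm_one] at h2
    have h3 := hsp χ
    rw [le_div_iff₀ hρ0] at hw
    nlinarith [norm_nonneg w, norm_nonneg (χ (u : B) - 1)]
  set p : ℂ → ℂ := fun w => 1 + (ρ : ℂ) ^ 2 * w + (ρ : ℂ) ^ 2 * w ^ 2 with hp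
  set H : ℂ → B := fun w => Ring.inverse (1 - w • x) with hH
  have hdH : ∀ w : ℂ, ‖w‖ ≤ 1 / ρ → DifferentiableAt ℂ H w := by
    intro w hw
    have h1 : DifferentiableAt ℂ (fun w : ℂ => 1 - w • x) w := by fun_prop
    exact (differentiableAt_inverse (𝕜 := ℂ) (hunit w hw)).comp w h1
  have hdp : Differentiable ℂ p := by fun_prop
  have hdf : DiffContOnCl ℂ (fun w => p w • H w) (ball 0 (1 / ρ)) := by
    refine DifferentiableOn.diffContOnCl fun w hw => ?_
    have : ‖w‖ ≤ 1 / ρ := by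
      have := closure_ball_subset_closedBall hw
      simpa using this
    exact ((hdp w).smul (hdH w this)).differentiableWithinAt
  have hbound : ∀ w ∈ sphere (0 : ℂ) (1 / ρ), ‖p w • H w‖ ≤ 3 * C ^ 2 := by
    intro w hw
    have hwn : ‖w‖ = 1 / ρ := by simpa using hw
    have hw0 : w ≠ 0 := by rw [← norm_pos_iff, hwn]; positivity
    set y := w⁻¹ with hy
    have hyn : ‖y‖ = ρ := by rw [hy, norm_inv, hwn]; simp
    set l := 1 + y with hl
    have hyy : y * (starRingEnd ℂ) y = (ρ : ℂ) ^ 2 := by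
      rw [Complex.mul_conj, Complex.normSq_eq_norm_sq, hyn]; push_cast; ring
    have hll : l * (starRingEnd ℂ) l = (‖l‖ : ℂ) ^ 2 := by
      rw [Complex.mul_conj, Complex.normSq_eq_norm_sq]; push_cast; ring
    have hpw : p w * y = ((‖l‖ : ℂ) ^ 2 - 1) := by
      have hwy : w * y = 1 := mul_inv_cancel₀ hw0
      rw [← hll, hl, map_add, map_one]
      simp only [hp]
      rw [← hyy]
      linear_combination (y * (starRingEnd ℂ) y + y * (starRingEnd ℂ) y * w
        + (starRingEnd ℂ) y) * hwy
    have hpn : ‖p w‖ * ρ = |‖l‖ - 1| * (‖l‖ + 1) := by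
      rw [← hyn, ← norm_mul, hpw]
      have : ((‖l‖ : ℂ) ^ 2 - 1) = (((‖l‖ - 1) * (‖l‖ + 1) : ℝ) : ℂ) := by push_cast; ring
      rw [this, Complex.norm_real, Real.norm_eq_abs, abs_mul, abs_of_pos (a := ‖l‖ + 1)]
      positivity
    have hl2 : ‖l‖ ≤ 2 := by
      calc ‖l‖ ≤ ‖(1 : ℂ)‖ + ‖y‖ := norm_add_le _ _
        _ ≤ 2 := by rw [hyn, norm_one]; linarith
    rw [norm_smul]
    by_cases hl1 : ‖l‖ = 1
    · have : ‖p w‖ = 0 := by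
        rw [hl1] at hpn
        simp at hpn
        rcases hpn with h | h
        · simp [h]
        · exact absurd h hρ0.ne'
      rw [this, zero_mul]; positivity
    · have hr : (algebraMap ℂ B l - u) * (w • H w) = 1 := by
        have h1 := Ring.mul_inverse_cancel _ (hunit w hwn.le)
        rw [mul_smul_comm, ← smul_mul_assoc]
        rw [show w • (algebraMap ℂ B l - (u : B)) = 1 - w • x from ?_]
        · exact h1
        · rw [hx, hl, Algebra.algebraMap_eq_smul_one, add_smul, one_smul, smul_sub, smul_sub,
            smul_add, smul_smul, hy, mul_inv_cancel₀ hw0, one_smul]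
          abel
      have h2 := norm_inverse_sub_le u hC1 hC hl1 hr
      rw [norm_smul, hwn] at h2
      have hpos : 0 < |‖l‖ - 1| := abs_pos.2 (sub_ne_zero.2 hl1)
      rw [le_div_iff₀ hpos] at h2
      have h3 : ‖p w‖ = |‖l‖ - 1| * (‖l‖ + 1) / ρ := by
        rw [eq_div_iff hρ0.ne']; exact hpn
      calc ‖p w‖ * ‖H w‖ = (‖l‖ + 1) * (1 / ρ * ‖H w‖ * |‖l‖ - 1|) := by rw [h3]; ring
        _ ≤ (2 + 1) * C ^ 2 := by gcongr
        _ = _ := by ring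
  have hderiv : deriv (fun w => p w • H w) 0 = (ρ : ℂ) ^ 2 • (1 : B) + x := by
    have h1 : HasDerivAt p ((ρ : ℂ) ^ 2) 0 := by
      have : HasDerivAt p (0 + (ρ : ℂ) ^ 2 * 1 + (ρ : ℂ) ^ 2 * (2 * (0 : ℂ) ^ (2 - 1) * 1)) 0 := by
        refine ((hasDerivAt_const _ _).add ((hasDerivAt_id (0:ℂ)).const_mul _)).add ?_
        exact (((hasDerivAt_id (0:ℂ)).pow 2).const_mul _)
      simpa using this
    have h2 : HasDerivAt H x 0 := by
      have h3 : HasFDerivAt Ring.inverse _ ((1 : Bˣ) : B) :=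
        hasFDerivAt_ringInverse (𝕜 := ℂ) (1 : Bˣ)
      have h4 : HasDerivAt (fun w : ℂ => 1 - w • x) (-x) 0 := by
        simpa using ((hasDerivAt_id (0:ℂ)).smul_const x).const_sub (1 : B)
      have h5 := HasFDerivAt.comp_hasDerivAt (x := (0 : ℂ)) (f := fun w : ℂ => 1 - w • x)
        (l := Ring.inverse) (by simpa using h3) h4
      simpa [Function.comp_def] using h5
    have h6 := (h1.smul h2).deriv
    change deriv (p • H) 0 = _
    rw [h6]
    simp [hp, hH, add_comm]
  have hmain := Complex.norm_deriv_le_of_forall_mem_sphere_norm_le (by positivity) hdf hbound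
  rw [hderiv] at hmain
  have h1 : ‖(1 : B)‖ ≤ C := by simpa using hC 0
  have hx2 : x = ((ρ : ℂ) ^ 2 • (1 : B) + x) - (ρ : ℂ) ^ 2 • (1 : B) := by abel
  rw [hx2]
  refine (norm_sub_le _ _).trans ?_
  have h7 : ‖(ρ : ℂ) ^ 2 • (1 : B)‖ ≤ ρ * C ^ 2 := by
    rw [norm_smul, norm_pow, Complex.norm_real, Real.norm_of_nonneg hρ0.le]
    calc ρ ^ 2 * ‖(1 : B)‖ ≤ ρ * 1 * C := by rw [sq]; gcongr
      _ ≤ ρ * C ^ 2 := by nlinarith [mul_nonneg hρ0.le (by linarith : (0:ℝ) ≤ C)]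
  have h8 : 3 * C ^ 2 / (1 / ρ) = 3 * C ^ 2 * ρ := by field_simp
  rw [h8] at hmain
  linarith

end BanachAlgebra

section Kronecker

theorem IsKronecker.norm_eq_one {K : Set ℂ} (hK : IsKronecker K) {z : ℂ} (hz : z ∈ K) :
    ‖z‖ = 1 := by simpa using hK.2.1 hz

/-- Kronecker sets are Dirichlet sets. -/
theorem IsKronecker.exists_pow_near_one {K : Set ℂ} (hK : IsKronecker K) {ρ : ℝ} (hρ : 0 < ρ) :
    ∃ n : ℕ, 0 < n ∧ ∀ z ∈ K, ‖z ^ n - 1‖ < ρ := by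
  rcases K.eq_empty_or_nonempty with rfl | ⟨z₀, hz₀⟩
  · exact ⟨1, one_pos, by simp⟩
  set t : ℝ := min (ρ / 3) 1 with ht
  have ht0 : 0 < t := by positivity
  have ht1 : t ≤ 1 := min_le_right _ _
  have htρ : t ≤ ρ / 3 := min_le_left _ _
  set c : ℂ := exp (I * t) with hc
  have hcn : ‖c‖ = 1 := by rw [hc, mul_comm]; exact norm_exp_ofReal_mul_I t
  have hc1 : ‖c - 1‖ ≤ t := by
    simpa [abs_of_pos ht0] using Real.norm_exp_I_mul_ofReal_sub_one_le (x := t)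
  have hc0 : c ≠ 1 := by
    intro h
    have h1 := congrArg Complex.im h
    rw [hc, mul_comm, exp_ofReal_mul_I_im, one_im] at h1
    exact (Real.sin_pos_of_pos_of_lt_pi ht0 (by linarith [Real.pi_gt_three])).ne' h1
  have hpos : 0 < ‖c - 1‖ := norm_pos_iff.2 (sub_ne_zero.2 hc0)
  obtain ⟨n, hn⟩ := hK.2.2 (fun _ => c) continuousOn_const (fun _ _ => hcn) _ hpos
  have hn0 : n ≠ 0 := by
    rintro rfl
    simpa using hn z₀ hz₀
  refine ⟨n.natAbs, Int.natAbs_pos.2 hn0, fun z hz => ?_⟩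
  have h1 : ‖z ^ n - 1‖ < ρ := by
    calc ‖z ^ n - 1‖ = ‖(c - 1) - (c - z ^ n)‖ := by congr 1; ring
      _ ≤ ‖c - 1‖ + ‖c - z ^ n‖ := norm_sub_le _ _
      _ < ρ := by linarith [hn z hz]
  have hz1 := hK.norm_eq_one hz
  have hz0 : z ≠ 0 := by rintro rfl; simp at hz1
  rcases Int.natAbs_eq n with h | h
  · rw [h, zpow_natCast] at h1; exact h1
  · have h2 : z ^ n.natAbs * (z ^ n - 1) = 1 - z ^ n.natAbs := by
      rw [mul_sub, ← zpow_natCast, ← zpow_add₀ hz0]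
      nth_rewrite 2 [h]
      simp
    rw [norm_sub_rev, ← h2, norm_mul, norm_pow, hz1, one_pow, one_mul]
    exact h1

end Kronecker

section AbstractSynthesis

open WeakDual Polynomial

variable {B : Type*} [NormedCommRing B] [NormedAlgebra ℂ B]

theorem exists_spectral_idempotents {φ : B} {n : ℕ} (hn : 0 < n) (hφ : φ ^ n = 1) :
    ∃ e : ℂ → B, ∑ ζ ∈ nthRootsFinset n (1 : ℂ), e ζ = 1 ∧
      ∀ ζ ∈ nthRootsFinset n (1 : ℂ), φ * e ζ = ζ • e ζ := by
  classical
  set S := nthRootsFinset n (1 : ℂ) with hS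
  refine ⟨fun ζ => aeval φ (Lagrange.basis S id ζ), ?_, ?_⟩
  · rw [← map_sum, Lagrange.sum_basis Function.injective_id.injOn, map_one]
    exact ⟨1, by simp [hS, mem_nthRootsFinset hn]⟩
  · intro ζ hζ
    have h1 : ∃ c : ℂ, (X - C ζ) * Lagrange.basis S id ζ = C c * (X ^ n - 1) := by
      refine ⟨∏ j ∈ S.erase ζ, (ζ - j)⁻¹, ?_⟩
      rw [X_pow_sub_one_eq_prod hn (Complex.isPrimitiveRoot_exp n hn.ne'), ← hS,
        ← Finset.mul_prod_erase S _ hζ, map_prod, mul_left_comm, ← Finset.prod_mul_distrib]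
      rfl
    obtain ⟨c, hc⟩ := h1
    have h2 := congrArg (aeval φ) hc
    simp only [map_mul, map_sub, aeval_X, aeval_C, map_pow, map_one, hφ, sub_self, mul_zero]
      at h2
    rw [Algebra.smul_def]
    linear_combination h2

variable [CompleteSpace B]

theorem norm_character_le (h1 : ‖(1 : B)‖ ≤ 1) (χ : characterSpace ℂ B) (a : B) :
    ‖χ a‖ ≤ ‖a‖ := by
  have h := spectrum.norm_le_norm_mul_of_mem (AlgHom.apply_mem_spectrum (R := ℂ) χ a)
  nlinarith [norm_nonneg a]

/-- An idempotent annihilated by every character vanishes. -/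
theorem eq_zero_of_idempotent {e : B} (he : e * e = e)
    (h : ∀ χ : characterSpace ℂ B, χ e = 0) : e = 0 := by
  have hu : IsUnit (1 - e) := isUnit_of_forall_character fun χ => by
    simp [map_sub, h χ]
  have h0 : (1 - e) * e = 0 := by rw [sub_mul, one_mul, he, sub_self]
  exact (hu.mul_right_eq_zero).1 h0

/-- Approximation of `T` by an element of finite order. -/
theorem exists_finite_order_approx {K : Set ℂ} (hK : IsKronecker K) (T : Bˣ)
    (hT : ∀ k : ℤ, ‖((T ^ k : Bˣ) : B)‖ ≤ 1)
    (hχ : ∀ χ : characterSpace ℂ B, χ (T : B) ∈ K) {δ : ℝ} (hδ : 0 < δ) :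
    ∃ n : ℕ, 0 < n ∧ ∃ (φ : B) (φ₀ : ℂ → ℂ), φ ^ n = 1 ∧ ‖(T : B) - φ‖ < δ ∧
      ContinuousOn φ₀ K ∧ (∀ z ∈ K, φ₀ z ^ n = 1) ∧ (∀ z ∈ K, ‖φ₀ z - z‖ < δ) ∧
      ∀ χ : characterSpace ℂ B, χ φ = φ₀ (χ (T : B)) := by
  let _ : NormedAlgebra ℚ B := NormedAlgebra.restrictScalars ℚ ℂ B
  have h1 : ‖(1 : B)‖ ≤ 1 := by simpa using hT 0
  have hT1 : ‖(T : B)‖ ≤ 1 := by simpa using hT 1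
  have hexp : HasStrictFDerivAt (NormedSpace.exp : B → B) (1 : B →L[ℂ] B) 0 :=
    hasStrictFDerivAt_exp_zero
  have hcont : ∀ᶠ a in nhds (0 : B), ‖NormedSpace.exp a - 1‖ < δ := by
    have h2 := hexp.hasFDerivAt.continuousAt
    have h3 := Metric.tendsto_nhds.1 h2 δ hδ
    filter_upwards [h3] with a ha
    simpa [NormedSpace.exp_zero, dist_eq_norm] using ha
  obtain ⟨η, hη0, hη⟩ := Metric.eventually_nhds_iff_ball.1 hcont
  have hmap : Filter.map (NormedSpace.exp : B → B) (nhds 0) = nhds 1 := by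
    have := hexp.map_nhds_eq_of_surj (by
      rw [LinearMap.range_eq_top]; exact fun x => ⟨x, rfl⟩)
    rwa [NormedSpace.exp_zero] at this
  have himg : NormedSpace.exp '' (ball (0 : B) (min η 1)) ∈ nhds (1 : B) := by
    rw [← hmap]
    exact image_mem_map (ball_mem_nhds _ (by positivity))
  obtain ⟨r, hr0, hr⟩ := Metric.mem_nhds_iff.1 himg
  have hlog : ∀ᶠ w in nhds (1 : ℂ), ‖log w‖ < min (δ / 2) 1 ∧ w ∈ slitPlane := by
    have h2 : ContinuousAt log 1 := continuousAt_clog (by simp)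
    have h3 := Metric.tendsto_nhds.1 h2 (min (δ / 2) 1) (by positivity)
    filter_upwards [h3, isOpen_slitPlane.mem_nhds one_mem_slitPlane] with w hw hw'
    exact ⟨by simpa using hw, hw'⟩
  obtain ⟨s, hs0, hs⟩ := Metric.eventually_nhds_iff_ball.1 hlog
  set ρ : ℝ := min (min (r / 5) s) 1 with hρ
  have hρ0 : 0 < ρ := by positivity
  obtain ⟨n, hn0, hn⟩ := hK.exists_pow_near_one hρ0
  have hnC : (n : ℂ) ≠ 0 := Nat.cast_ne_zero.2 hn0.ne'
  have hn1 : (1 : ℝ) ≤ n := by exact_mod_cast hn0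
  have hninv : ‖(n : ℂ)⁻¹‖ ≤ 1 := by
    rw [norm_inv, Complex.norm_natCast]; exact inv_le_one_of_one_le₀ hn1
  have hsK : ∀ z ∈ K, ‖log (z ^ n)‖ < min (δ / 2) 1 ∧ z ^ n ∈ slitPlane := fun z hz =>
    hs _ (by
      rw [mem_ball, dist_eq_norm]
      exact (hn z hz).trans_le ((min_le_left _ _).trans (min_le_right _ _)))
  have hTn : ‖((T ^ n : Bˣ) : B) - 1‖ < r := by
    have := norm_sub_one_le_of_character (T ^ n) (C := 1) le_rfl
      (fun k => by rw [← zpow_natCast, ← zpow_mul]; exact hT _) hρ0 (min_le_right _ _)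
      (fun χ => by
        rw [Units.val_pow_eq_pow_val, map_pow]
        exact hn _ (hχ χ))
    have h2 : ρ ≤ r / 5 := (min_le_left _ _).trans (min_le_left _ _)
    linarith
  obtain ⟨a, ha, hae⟩ := hr (show ((T ^ n : Bˣ) : B) ∈ ball 1 r by rwa [mem_ball, dist_eq_norm])
  have ha' : ‖a‖ < min η 1 := by simpa using ha
  have hexpχ : ∀ (χ : characterSpace ℂ B) (b : B), χ (NormedSpace.exp b) = exp (χ b) := by
    intro χ b
    rw [NormedSpace.map_exp χ (map_continuous χ) b, exp_eq_exp_ℂ]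
  have hχa : ∀ χ : characterSpace ℂ B, χ a = log (χ (T : B) ^ n) := by
    intro χ
    have h2 : exp (χ a) = χ (T : B) ^ n := by
      rw [← hexpχ, hae, Units.val_pow_eq_pow_val, map_pow]
    have h3 : |(χ a).im| < 1 :=
      ((abs_im_le_norm _).trans (norm_character_le h1 χ a)).trans_lt
        (ha'.trans_le (min_le_right _ _))
    rw [abs_lt] at h3
    rw [← h2, log_exp] <;> linarith [Real.pi_gt_three]
  refine ⟨n, hn0, (T : B) * NormedSpace.exp (-((n : ℂ)⁻¹ • a)),
    fun z => z * exp (-((n : ℂ)⁻¹ * log (z ^ n))), ?_, ?_, ?_, ?_, ?_, ?_⟩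
  · rw [mul_pow, ← NormedSpace.exp_nsmul, smul_neg, ← Nat.cast_smul_eq_nsmul ℂ, smul_smul,
      mul_inv_cancel₀ hnC, one_smul, ← Units.val_pow_eq_pow_val, ← hae, ← NormedSpace.exp_add,
      add_neg_cancel, NormedSpace.exp_zero]
  · have h2 : ‖NormedSpace.exp (-((n : ℂ)⁻¹ • a)) - 1‖ < δ := by
      refine hη _ ?_
      rw [mem_ball_zero_iff, norm_neg, norm_smul]
      calc _ ≤ 1 * ‖a‖ := by gcongr
        _ < η := by rw [one_mul]; exact ha'.trans_le (min_le_left _ _)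
    have h3 : (T : B) - T * NormedSpace.exp (-((n : ℂ)⁻¹ • a))
        = -(T * (NormedSpace.exp (-((n : ℂ)⁻¹ • a)) - 1)) := by ring
    rw [h3, norm_neg]
    refine (norm_mul_le _ _).trans_lt ?_
    nlinarith [norm_nonneg (NormedSpace.exp (-((n : ℂ)⁻¹ • a)) - 1)]
  · refine continuousOn_id.mul (continuous_exp.comp_continuousOn ?_)
    refine (continuousOn_const.mul (ContinuousOn.clog (by fun_prop) fun z hz => ?_)).neg
    exact (hsK z hz).2
  · intro z hz
    have hz0 : z ≠ 0 := by
      rintro rfl; simpa using hK.norm_eq_one hz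
    rw [mul_pow, ← exp_nat_mul]
    have h2 : (n : ℂ) * -((n : ℂ)⁻¹ * log (z ^ n)) = -log (z ^ n) := by field_simp
    rw [h2, exp_neg, exp_log (pow_ne_zero _ hz0), mul_inv_cancel₀ (pow_ne_zero _ hz0)]
  · intro z hz
    have h2 : ‖-((n : ℂ)⁻¹ * log (z ^ n))‖ ≤ ‖log (z ^ n)‖ := by
      rw [norm_neg, norm_mul]
      nlinarith [norm_nonneg (log (z ^ n))]
    have h3 := (hsK z hz).1
    have h4 := norm_exp_sub_one_le (h2.trans (h3.le.trans (min_le_right _ _)))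
    have h5 : z * exp (-((n : ℂ)⁻¹ * log (z ^ n))) - z
        = z * (exp (-((n : ℂ)⁻¹ * log (z ^ n))) - 1) := by ring
    rw [h5, norm_mul, hK.norm_eq_one hz, one_mul]
    have h6 := h3.trans_le (min_le_left _ _)
    linarith
  · intro χ
    rw [map_mul, hexpχ, map_neg, map_smul, hχa, smul_eq_mul]

end AbstractSynthesis

section AbstractSynthesis

open WeakDual Polynomial

theorem sum_smul_mul_sum_smul {B : Type*} [CommRing B] [Algebra ℂ B] {S : Finset ℂ} {e : ℂ → B}
    (he : ∀ ζ ∈ S, ∀ ξ ∈ S, e ζ * e ξ = if ζ = ξ then e ζ else 0) (s t : ℂ → ℂ) :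
    (∑ ζ ∈ S, s ζ • e ζ) * (∑ ζ ∈ S, t ζ • e ζ) = ∑ ζ ∈ S, (s ζ * t ζ) • e ζ := by
  rw [Finset.sum_mul_sum]
  refine Finset.sum_congr rfl fun ζ hζ => ?_
  rw [Finset.sum_eq_single_of_mem ζ hζ]
  · rw [smul_mul_smul_comm, he ζ hζ ζ hζ, if_pos rfl]
  · intro ξ hξ hne
    rw [smul_mul_smul_comm, he ζ hζ ξ hξ, if_neg hne.symm, smul_zero]

/-- A norm bound valid for all sign combinations extends to all real combinations with
coefficients in `[-1, 1]`. -/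
theorem norm_sum_smul_le_of_signs {B : Type*} [NormedAddCommGroup B] [NormedSpace ℂ B]
    {S : Finset ℂ} {e : ℂ → B} {C : ℝ}
    (h : ∀ s : ℂ → ℝ, (∀ ζ, s ζ = 1 ∨ s ζ = -1) → ‖∑ ζ ∈ S, (s ζ : ℂ) • e ζ‖ ≤ C)
    (t : ℂ → ℝ) (ht : ∀ ζ ∈ S, |t ζ| ≤ 1) : ‖∑ ζ ∈ S, (t ζ : ℂ) • e ζ‖ ≤ C := by
  classical
  have key : ∀ R ⊆ S, ∀ s : ℂ → ℝ, (∀ ζ, s ζ = 1 ∨ s ζ = -1) →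
      ‖∑ ζ ∈ S, (((if ζ ∈ R then t ζ else s ζ) : ℝ) : ℂ) • e ζ‖ ≤ C := by
    intro R
    induction R using Finset.induction_on with
    | empty => intro _ s hs; simpa using h s hs
    | insert a R ha ih =>
      intro hR s hs
      have haS : a ∈ S := hR (Finset.mem_insert_self _ _)
      have ih' := ih ((Finset.subset_insert _ _).trans hR)
      have h1 := ih' (Function.update s a 1) (fun ζ => by
        by_cases hζ : ζ = a
        · simp [hζ]
        · simpa [Function.update_of_ne hζ] using hs ζ)
      have h2 := ih' (Function.update s a (-1)) (fun ζ => by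
        by_cases hζ : ζ = a
        · simp [hζ]
        · simpa [Function.update_of_ne hζ] using hs ζ)
      have hta := abs_le.1 (ht a haS)
      have hcomb : ∑ ζ ∈ S, (((if ζ ∈ insert a R then t ζ else s ζ) : ℝ) : ℂ) • e ζ
          = ((1 + t a) / 2) • (∑ ζ ∈ S, (((if ζ ∈ R then t ζ else
              Function.update s a 1 ζ) : ℝ) : ℂ) • e ζ)
            + ((1 - t a) / 2) • (∑ ζ ∈ S, (((if ζ ∈ R then t ζ else
              Function.update s a (-1) ζ) : ℝ) : ℂ) • e ζ) := by
        rw [Finset.smul_sum, Finset.smul_sum, ← Finset.sum_add_distrib]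
        refine Finset.sum_congr rfl fun ζ _ => ?_
        rw [← Complex.coe_smul, ← Complex.coe_smul, smul_smul, smul_smul, ← add_smul]
        congr 1
        by_cases hζ : ζ = a
        · subst hζ
          simp only [Finset.mem_insert, true_or, if_true, ha, if_false, Function.update_self]
          push_cast; ring
        · simp only [Finset.mem_insert, hζ, false_or, Function.update_of_ne hζ]
          push_cast; ring
      rw [hcomb]
      refine (norm_add_le _ _).trans ?_
      rw [norm_smul, norm_smul, Real.norm_of_nonneg (by linarith),
        Real.norm_of_nonneg (by linarith)]
      nlinarith
  have := key S subset_rfl (fun _ => 1) (fun _ => Or.inl rfl)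
  refine le_of_eq_of_le (congrArg norm (Finset.sum_congr rfl fun ζ hζ => ?_)) this
  rw [if_pos hζ]

variable {B : Type*} [NormedCommRing B] [NormedAlgebra ℂ B]

theorem character_zpow (χ : characterSpace ℂ B) (T : Bˣ) (n : ℤ) :
    χ ((T ^ n : Bˣ) : B) = χ (T : B) ^ n := by
  have h := congrArg Units.val (map_zpow (Units.map (MonoidHomClass.toMonoidHom χ)) T n)
  rw [Units.val_zpow_eq_zpow_val] at h
  exact h

variable [CompleteSpace B]

/-- A self-inverse element whose Gelfand transform is a continuous sign function of the
Gelfand transform of `T` has norm at most `1`. -/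
theorem norm_sign_le_one {K : Set ℂ} (hK : IsKronecker K) (T : Bˣ)
    (hT : ∀ k : ℤ, ‖((T ^ k : Bˣ) : B)‖ ≤ 1)
    (hχ : ∀ χ : characterSpace ℂ B, χ (T : B) ∈ K) {ψ : B} {ψ₀ : ℂ → ℂ} (hψ : ψ * ψ = 1)
    (hψ₀ : ContinuousOn ψ₀ K) (hsq : ∀ z ∈ K, ψ₀ z * ψ₀ z = 1)
    (hψχ : ∀ χ : characterSpace ℂ B, χ ψ = ψ₀ (χ (T : B))) : ‖ψ‖ ≤ 1 := by
  set Ψ : Bˣ := ⟨ψ, ψ, hψ, hψ⟩ with hΨ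
  have hΨ2 : Ψ ^ 2 = 1 := by rw [sq]; ext; exact hψ
  set C : ℝ := max 1 ‖ψ‖ with hC
  have h1 : ‖(1 : B)‖ ≤ 1 := by simpa using hT 0
  have hpow : ∀ k : ℤ, ‖((Ψ ^ k : Bˣ) : B)‖ ≤ C := by
    intro k
    rcases Int.even_or_odd' k with ⟨m, rfl | rfl⟩
    · have : Ψ ^ (2 * m) = 1 := by rw [zpow_mul]; norm_cast; rw [hΨ2, one_zpow]
      rw [this, Units.val_one]; exact h1.trans (le_max_left _ _)
    · have : Ψ ^ (2 * m + 1) = Ψ := by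
        rw [zpow_add, zpow_mul, zpow_one]; norm_cast; rw [hΨ2, one_zpow, one_mul]
      rw [this]; exact le_max_right _ _
  have hnorm : ∀ z ∈ K, ‖ψ₀ z‖ = 1 := by
    intro z hz
    have := congrArg norm (hsq z hz)
    rw [norm_mul, norm_one] at this
    nlinarith [norm_nonneg (ψ₀ z)]
  have key : ∀ ρ : ℝ, 0 < ρ → ρ ≤ 1 → ‖ψ‖ ≤ 1 + 4 * C ^ 2 * ρ := by
    intro ρ hρ0 hρ1
    obtain ⟨n, hn⟩ := hK.2.2 ψ₀ hψ₀ hnorm ρ hρ0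
    have h2 := norm_sub_one_le_of_character (T ^ n * Ψ) (le_max_left 1 ‖ψ‖) (fun k => by
      rw [mul_zpow, Units.val_mul, ← zpow_mul]
      refine (norm_mul_le _ _).trans ?_
      have := hT (n * k)
      have := hpow k
      nlinarith [norm_nonneg ((Ψ ^ k : Bˣ) : B)]) hρ0 hρ1 (fun χ => by
        have h3 : χ ((T ^ n : Bˣ) : B) = χ (T : B) ^ n := by
          exact character_zpow χ T n
        rw [Units.val_mul, map_mul, h3, hψχ]
        have h4 := hsq _ (hχ χ)
        have h5 : χ (T : B) ^ n * ψ₀ (χ (T : B)) - 1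
            = - ((ψ₀ (χ (T : B)) - χ (T : B) ^ n) * ψ₀ (χ (T : B))) := by
          linear_combination h4
        rw [h5, norm_neg, norm_mul, hnorm _ (hχ χ), mul_one]
        exact hn _ (hχ χ))
    have h6 : ψ = ((T ^ (-n) : Bˣ) : B) * (((T ^ n * Ψ : Bˣ) : B) - 1) + ((T ^ (-n) : Bˣ) : B) := by
      rw [mul_sub, ← Units.val_mul, ← mul_assoc, ← zpow_add]
      simp [hΨ]
    have h7 := hT (-n)
    calc ‖ψ‖
        ≤ ‖((T ^ (-n) : Bˣ) : B)‖ * ‖((T ^ n * Ψ : Bˣ) : B) - 1‖ + ‖((T ^ (-n) : Bˣ) : B)‖ := by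
          nth_rewrite 1 [h6]
          exact (norm_add_le _ _).trans (add_le_add (norm_mul_le _ _) le_rfl)
      _ ≤ 1 * (4 * C ^ 2 * ρ) + 1 := by gcongr
      _ = _ := by ring
  refine le_of_forall_pos_le_add fun ε hε => ?_
  have hC1 : 1 ≤ C := le_max_left _ _
  have h := key (min 1 (ε / (4 * C ^ 2))) (by positivity) (min_le_left _ _)
  have h2 : 4 * C ^ 2 * min 1 (ε / (4 * C ^ 2)) ≤ ε := by
    calc _ ≤ 4 * C ^ 2 * (ε / (4 * C ^ 2)) := by gcongr; exact min_le_right _ _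
      _ = ε := by field_simp
  linarith

/-- Functional calculus bound for an element of finite order. -/
theorem norm_aeval_le_of_finite_order {K : Set ℂ} (hK : IsKronecker K) (T : Bˣ)
    (hT : ∀ k : ℤ, ‖((T ^ k : Bˣ) : B)‖ ≤ 1)
    (hχ : ∀ χ : characterSpace ℂ B, χ (T : B) ∈ K) {n : ℕ} (hn : 0 < n) {φ : B} {φ₀ : ℂ → ℂ}
    (hφ : φ ^ n = 1) (hφc : ContinuousOn φ₀ K) (hφn : ∀ z ∈ K, φ₀ z ^ n = 1)
    (hφχ : ∀ χ : characterSpace ℂ B, χ φ = φ₀ (χ (T : B))) {p : ℂ[X]} {M : ℝ} (hM : 0 < M)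
    (hp : ∀ z ∈ K, ‖p.eval (φ₀ z)‖ ≤ M) : ‖aeval φ p‖ ≤ 2 * M := by
  classical
  obtain ⟨e, he1, heφ⟩ := exists_spectral_idempotents hn hφ
  set S := nthRootsFinset n (1 : ℂ) with hS
  have horth : ∀ ζ ∈ S, ∀ ξ ∈ S, ζ ≠ ξ → e ζ * e ξ = 0 := by
    intro ζ hζ ξ hξ hne
    have h : (ζ - ξ) • (e ζ * e ξ) = 0 := by
      rw [sub_smul, ← smul_mul_assoc, ← heφ ζ hζ, ← mul_smul_comm, ← heφ ξ hξ]; ring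
    exact (smul_eq_zero.1 h).resolve_left (sub_ne_zero.2 hne)
  have hidem : ∀ ζ ∈ S, e ζ * e ζ = e ζ := by
    intro ζ hζ
    have h := congrArg (e ζ * ·) he1
    simp only [Finset.mul_sum, mul_one] at h
    rwa [Finset.sum_eq_single_of_mem ζ hζ
      fun ξ hξ hne => horth ζ hζ ξ hξ hne.symm] at h
  have he : ∀ ζ ∈ S, ∀ ξ ∈ S, e ζ * e ξ = if ζ = ξ then e ζ else 0 := by
    intro ζ hζ ξ hξ
    split_ifs with h
    · rw [← h]; exact hidem ζ hζ
    · exact horth ζ hζ ξ hξ h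
  have hχe : ∀ χ : characterSpace ℂ B, ∀ ζ ∈ S, ζ ≠ φ₀ (χ (T : B)) → χ (e ζ) = 0 := by
    intro χ ζ hζ hne
    have h := congrArg χ (heφ ζ hζ)
    rw [map_mul, map_smul, hφχ, smul_eq_mul] at h
    have h2 : (φ₀ (χ (T : B)) - ζ) * χ (e ζ) = 0 := by linear_combination h
    exact (mul_eq_zero.1 h2).resolve_left (sub_ne_zero.2 hne.symm)
  have hmemS : ∀ z ∈ K, φ₀ z ∈ S := fun z hz => (mem_nthRootsFinset hn _).2 (hφn z hz)
  have hχ1 : ∀ χ : characterSpace ℂ B, χ (e (φ₀ (χ (T : B)))) = 1 := by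
    intro χ
    have h := congrArg χ he1
    rw [map_sum, map_one, Finset.sum_eq_single_of_mem _ (hmemS _ (hχ χ))] at h
    · exact h
    · exact fun ζ hζ hne => hχe χ ζ hζ hne
  have hχs : ∀ (χ : characterSpace ℂ B) (s : ℂ → ℂ),
      χ (∑ ζ ∈ S, s ζ • e ζ) = s (φ₀ (χ (T : B))) := by
    intro χ s
    rw [map_sum, Finset.sum_eq_single_of_mem _ (hmemS _ (hχ χ))]
    · rw [map_smul, hχ1, smul_eq_mul, mul_one]
    · intro ζ hζ hne
      rw [map_smul, hχe χ ζ hζ hne, smul_zero]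
  have hsign : ∀ s : ℂ → ℝ, (∀ ζ, s ζ = 1 ∨ s ζ = -1) → ‖∑ ζ ∈ S, (s ζ : ℂ) • e ζ‖ ≤ 1 := by
    intro s hs
    have hss : ∀ ζ, (s ζ : ℂ) * s ζ = 1 := by
      intro ζ; rcases hs ζ with h | h <;> rw [h] <;> norm_num
    refine norm_sign_le_one hK T hT hχ (ψ₀ := fun z => (s (φ₀ z) : ℂ)) ?_ ?_ ?_ ?_
    · rw [sum_smul_mul_sum_smul he, ← he1]
      exact Finset.sum_congr rfl fun ζ _ => by rw [hss, one_smul]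
    · exact (S.finite_toSet.continuousOn fun ζ => (s ζ : ℂ)).comp hφc
        (fun z hz => hmemS z hz)
    · exact fun z _ => hss _
    · exact fun χ => hχs χ fun ζ => (s ζ : ℂ)
  have hoff : ∀ ζ ∈ S, ζ ∉ φ₀ '' K → e ζ = 0 := by
    intro ζ hζ hne
    refine eq_zero_of_idempotent (hidem ζ hζ) fun χ => hχe χ ζ hζ ?_
    rintro rfl
    exact hne ⟨_, hχ χ, rfl⟩
  have hpe : ∀ ζ ∈ S, aeval φ p * e ζ = p.eval ζ • e ζ := by
    intro ζ hζ
    clear hp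
    induction p using Polynomial.induction_on with
    | C a => rw [aeval_C, eval_C, Algebra.smul_def]
    | add p q hp hq => rw [map_add, add_mul, hp, hq, eval_add, add_smul]
    | monomial k c ih =>
      rw [pow_succ, ← mul_assoc, map_mul, aeval_X, mul_assoc, heφ ζ hζ, mul_smul_comm, ih,
        smul_smul, eval_mul (q := X), eval_X, mul_comm ζ]
  have hsum : aeval φ p = ∑ ζ ∈ S, p.eval ζ • e ζ := by
    rw [← mul_one (aeval φ p), ← he1, Finset.mul_sum]
    exact Finset.sum_congr rfl hpe
  have hreal : ∀ t : ℂ → ℝ, (∀ z ∈ K, |t (φ₀ z)| ≤ M) → ‖∑ ζ ∈ S, (t ζ : ℂ) • e ζ‖ ≤ M := by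
    intro t ht
    have h := norm_sum_smul_le_of_signs hsign
      (fun ζ => if ζ ∈ φ₀ '' K then t ζ / M else 0) (by
        intro ζ _
        split_ifs with h
        · obtain ⟨z, hz, rfl⟩ := h
          rw [abs_div, abs_of_pos hM]
          exact div_le_one_of_le₀ (ht z hz) hM.le
        · simp)
    have h2 : ∑ ζ ∈ S, (t ζ : ℂ) • e ζ
        = (M : ℂ) • ∑ ζ ∈ S, (((if ζ ∈ φ₀ '' K then t ζ / M else 0) : ℝ) : ℂ) • e ζ := by
      rw [Finset.smul_sum]
      refine Finset.sum_congr rfl fun ζ hζ => ?_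
      split_ifs with h3
      · rw [smul_smul]
        congr 1
        push_cast
        rw [mul_div_cancel₀]
        exact_mod_cast hM.ne'
      · rw [hoff ζ hζ h3, smul_zero, smul_zero, smul_zero]
    rw [h2, norm_smul, Complex.norm_real, Real.norm_of_nonneg hM.le]
    nlinarith
  have hre := hreal (fun ζ => (p.eval ζ).re) fun z hz => (abs_re_le_norm _).trans (hp z hz)
  have him := hreal (fun ζ => (p.eval ζ).im) fun z hz => (abs_im_le_norm _).trans (hp z hz)
  have hsplit : aeval φ p = ∑ ζ ∈ S, ((p.eval ζ).re : ℂ) • e ζ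
      + I • ∑ ζ ∈ S, ((p.eval ζ).im : ℂ) • e ζ := by
    rw [hsum, Finset.smul_sum, ← Finset.sum_add_distrib]
    refine Finset.sum_congr rfl fun ζ _ => ?_
    rw [smul_smul, ← add_smul, mul_comm I, re_add_im]
  rw [hsplit]
  refine (norm_add_le _ _).trans ?_
  rw [norm_smul, norm_I, one_mul]
  linarith

end AbstractSynthesis

section AbstractSynthesis

open WeakDual Polynomial

theorem norm_sub_sum_le_of_disjoint {ι E : Type*} [NormedAddCommGroup E] {f : ι → E} {a : E}
    {c : ι → ℝ} {F : Finset ι} {η : ℝ} (hF : ∀ t : Finset ι, Disjoint t F → ∑ k ∈ t, c k ≤ η)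
    (hf : ∀ k, ‖f k‖ ≤ c k) (ha : HasSum f a) : ‖a - ∑ k ∈ F, f k‖ ≤ η := by
  classical
  have h : Tendsto (fun G : Finset ι => ‖∑ k ∈ G, f k - ∑ k ∈ F, f k‖) atTop
      (nhds ‖a - ∑ k ∈ F, f k‖) := (Tendsto.sub_const ha _).norm
  refine le_of_tendsto h ?_
  filter_upwards [eventually_ge_atTop F] with G hG
  rw [← Finset.sum_sdiff hG, add_sub_cancel_right]
  exact (norm_sum_le_of_le _ fun k _ => hf k).trans (hF _ Finset.sdiff_disjoint)

variable {B : Type*} [NormedCommRing B] [NormedAlgebra ℂ B] [CompleteSpace B]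

theorem norm_aeval_le_of_kronecker {K : Set ℂ} (hK : IsKronecker K) (T : Bˣ)
    (hT : ∀ k : ℤ, ‖((T ^ k : Bˣ) : B)‖ ≤ 1)
    (hχ : ∀ χ : characterSpace ℂ B, χ (T : B) ∈ K) {p : ℂ[X]} {M : ℝ} (hM : 0 < M)
    (hp : ∀ z ∈ K, ‖p.eval z‖ ≤ M) : ‖aeval (T : B) p‖ ≤ 2 * M := by
  refine le_of_forall_pos_le_add fun η hη => ?_
  have huc : UniformContinuousOn (fun z => p.eval z) (closedBall (0 : ℂ) 2) :=
    (ProperSpace.isCompact_closedBall _ _).uniformContinuousOn_of_continuous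
      p.continuous.continuousOn
  obtain ⟨δ₁, hδ₁, h₁⟩ := Metric.uniformContinuousOn_iff.1 huc (η / 3) (by positivity)
  have hc : Continuous fun b : B => aeval b p := p.continuous_aeval
  obtain ⟨δ₂, hδ₂, h₂⟩ := Metric.continuousAt_iff.1 hc.continuousAt (η / 3) (by positivity)
  obtain ⟨n, hn, φ, φ₀, hφ, hφT, hφc, hφn, hφz, hφχ⟩ :=
    exists_finite_order_approx hK T hT hχ (δ := min (min δ₁ δ₂) 1) (by positivity)
  have hbound : ∀ z ∈ K, ‖p.eval (φ₀ z)‖ ≤ M + η / 3 := by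
    intro z hz
    have hz1 := hK.norm_eq_one hz
    have hd := hφz z hz
    have hw : ‖φ₀ z‖ = 1 := by
      have := congrArg norm (hφn z hz)
      rw [norm_pow, norm_one] at this
      exact (pow_eq_one_iff_of_nonneg (norm_nonneg _) hn.ne').1 this
    have h3 := h₁ (φ₀ z) (by simp [hw]) z (by simp [hz1])
      (by rw [dist_eq_norm]; exact hd.trans_le ((min_le_left _ _).trans (min_le_left _ _)))
    rw [dist_eq_norm] at h3
    calc ‖p.eval (φ₀ z)‖ = ‖p.eval z + (p.eval (φ₀ z) - p.eval z)‖ := by congr 1; ring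
      _ ≤ M + η / 3 := (norm_add_le _ _).trans (add_le_add (hp z hz) h3.le)
  have h4 := norm_aeval_le_of_finite_order hK T hT hχ hn hφ hφc hφn hφχ (p := p)
    (M := M + η / 3) (by positivity) hbound
  have h5 := h₂ (x := φ) (by
    rw [dist_eq_norm, norm_sub_rev]
    exact hφT.trans_le ((min_le_left _ _).trans (min_le_right _ _)))
  rw [dist_eq_norm] at h5
  have h6 : aeval (T : B) p = aeval φ p - (aeval φ p - aeval (T : B) p) := by ring
  rw [h6]
  refine (norm_sub_le _ _).trans ?_
  linarith

/-- Spectral synthesis for Kronecker sets: an absolutely convergent trigonometric series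
vanishing on `K` annihilates every doubly contractive element with spectrum in `K`. -/
theorem hasSum_zero_of_kronecker {K : Set ℂ} (hK : IsKronecker K) (T : Bˣ)
    (hT : ∀ k : ℤ, ‖((T ^ k : Bˣ) : B)‖ ≤ 1)
    (hχ : ∀ χ : characterSpace ℂ B, χ (T : B) ∈ K) {c : ℤ → ℂ} (hc : Summable fun k => ‖c k‖)
    (hcK : ∀ z ∈ K, HasSum (fun k => c k * z ^ k) 0) {b : B}
    (hb : HasSum (fun k => c k • ((T ^ k : Bˣ) : B)) b) : b = 0 := by
  rw [← norm_le_zero_iff]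
  refine le_of_forall_pos_le_add fun η hη => ?_
  obtain ⟨F, hF⟩ := summable_iff_vanishing_norm.1 hc (η / 3) (by positivity)
  have hF' : ∀ t : Finset ℤ, Disjoint t F → ∑ k ∈ t, ‖c k‖ ≤ η / 3 := fun t ht =>
    (le_abs_self _).trans (hF t ht).le
  set N : ℕ := F.sup Int.natAbs with hN
  have hNF : ∀ k ∈ F, 0 ≤ k + N := by
    intro k hk
    have : k.natAbs ≤ N := Finset.le_sup (f := Int.natAbs) hk
    omega
  set p : ℂ[X] := ∑ k ∈ F, C (c k) * X ^ (k + N).toNat with hp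
  have hpT : aeval (T : B) p = ((T ^ (N : ℤ) : Bˣ) : B) * ∑ k ∈ F, c k • ((T ^ k : Bˣ) : B) := by
    rw [hp, map_sum, Finset.mul_sum]
    refine Finset.sum_congr rfl fun k hk => ?_
    rw [map_mul, aeval_C, map_pow, aeval_X, mul_smul_comm, ← Units.val_mul, ← zpow_add,
      Algebra.smul_def, ← Units.val_pow_eq_pow_val, ← zpow_natCast, Int.toNat_of_nonneg (hNF k hk),
      add_comm k]
  have hpz : ∀ z ∈ K, ‖p.eval z‖ ≤ η / 3 := by
    intro z hz
    have hz1 := hK.norm_eq_one hz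
    have hz0 : z ≠ 0 := by rintro rfl; simp at hz1
    have h1 : p.eval z = z ^ (N : ℤ) * ∑ k ∈ F, c k * z ^ k := by
      rw [hp, eval_finsetSum, Finset.mul_sum]
      refine Finset.sum_congr rfl fun k hk => ?_
      rw [eval_mul, eval_C, eval_pow, eval_X, mul_left_comm, ← zpow_add₀ hz0, ← zpow_natCast,
        Int.toNat_of_nonneg (hNF k hk), add_comm k]
    have h2 := norm_sub_sum_le_of_disjoint hF' (fun k => by rw [norm_mul, norm_zpow, hz1]; simp)
      (hcK z hz)
    rw [zero_sub, norm_neg] at h2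
    rw [h1, norm_mul, norm_zpow, hz1, one_zpow, one_mul]
    exact h2
  have h3 := norm_aeval_le_of_kronecker hK T hT hχ (by positivity) hpz
  have h4 := norm_sub_sum_le_of_disjoint hF' (fun k => by
    rw [norm_smul]
    exact mul_le_of_le_one_right (norm_nonneg _) (hT k)) hb
  have h5 : b = (b - ∑ k ∈ F, c k • ((T ^ k : Bˣ) : B))
      + ((T ^ (-N : ℤ) : Bˣ) : B) * aeval (T : B) p := by
    rw [hpT, ← mul_assoc, ← Units.val_mul, ← zpow_add]
    simp
  rw [h5]
  refine (norm_add_le _ _).trans ?_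
  have h6 := norm_mul_le ((T ^ (-N : ℤ) : Bˣ) : B) (aeval (T : B) p)
  have h7 := hT (-N)
  nlinarith [norm_nonneg (aeval (T : B) p)]

end AbstractSynthesis

section WienerAlgebra

theorem integral_exp_int_mul (m : ℤ) :
    (∫ θ in (0:ℝ)..(2 * Real.pi), exp ((m : ℂ) * I * θ)) = if m = 0 then 2 * Real.pi else 0 := by
  split_ifs with h
  · simp [h]
  · rw [integral_exp_mul_complex (mul_ne_zero (Int.cast_ne_zero.2 h) I_ne_zero)]
    have : exp ((m : ℂ) * I * ((2 * Real.pi : ℝ) : ℂ)) = 1 := by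
      rw [exp_eq_one_iff]; exact ⟨m, by push_cast; ring⟩
    rw [this]; simp

/-- Absolutely convergent Fourier expansions are unique. -/
theorem fcoeff_eq_of_hasSum {f : ℂ → ℂ} {c : ℤ → ℂ} (hc : Summable fun k => ‖c k‖)
    (hf : ∀ z ∈ sphere (0 : ℂ) 1, HasSum (fun k => c k * z ^ k) (f z)) : fcoeff f = c := by
  funext n
  have h1 : HasSum (fun k : ℤ => ∫ θ in (0:ℝ)..(2 * Real.pi),
      c k * exp (((k - n : ℤ) : ℂ) * I * θ))
      (∫ θ in (0:ℝ)..(2 * Real.pi), f (exp ((θ : ℂ) * I)) * exp (-(n : ℂ) * (θ : ℂ) * I)) := by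
    refine intervalIntegral.hasSum_integral_of_dominated_convergence (fun k _ => ‖c k‖)
      (fun k => ?_) (fun k => ae_of_all _ fun θ _ => ?_) (ae_of_all _ fun _ _ => hc)
      intervalIntegrable_const (ae_of_all _ fun θ _ => ?_)
    · exact (by fun_prop : Continuous fun θ : ℝ =>
        c k * exp (((k - n : ℤ) : ℂ) * I * θ)).aestronglyMeasurable
    · rw [norm_mul, show ((k - n : ℤ) : ℂ) * I * θ = (((k - n : ℤ) * θ : ℝ) : ℂ) * I by
        push_cast; ring, norm_exp_ofReal_mul_I, mul_one]
    · have h2 := (hf (exp ((θ : ℂ) * I)) (by simp [norm_exp_ofReal_mul_I])).mul_right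
        (exp (-(n : ℂ) * (θ : ℂ) * I))
      refine h2.congr_fun fun k => ?_
      rw [← exp_int_mul, mul_assoc (c k), ← exp_add]
      congr 2
      push_cast; ring
  have h2 : (∫ θ in (0:ℝ)..(2 * Real.pi), f (exp ((θ : ℂ) * I)) * exp (-(n : ℂ) * (θ : ℂ) * I))
      = 2 * Real.pi * c n := by
    rw [← h1.tsum_eq, tsum_eq_single n]
    · rw [intervalIntegral.integral_const_mul, integral_exp_int_mul, if_pos (sub_self n), mul_comm]
      push_cast; ring
    · intro k hk
      rw [intervalIntegral.integral_const_mul, integral_exp_int_mul,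
        if_neg (sub_ne_zero.2 hk), ofReal_zero, mul_zero]
  have hpi : (Real.pi : ℂ) ≠ 0 := by exact_mod_cast Real.pi_ne_zero
  rw [fcoeff, h2]
  field_simp

theorem mem_wienerAlg_of_hasSum {f : ℂ → ℂ} {c : ℤ → ℂ} (hc : Summable fun k => ‖c k‖)
    (hf : ∀ z ∈ sphere (0 : ℂ) 1, HasSum (fun k => c k * z ^ k) (f z)) : f ∈ WienerAlg := by
  rw [WienerAlg, mem_ofPred_eq, fcoeff_eq_of_hasSum hc hf]
  exact ⟨hc, hf⟩

theorem norm_le_wienerNorm {f : ℂ → ℂ} (hf : f ∈ WienerAlg) {z : ℂ} (hz : z ∈ sphere (0 : ℂ) 1) :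
    ‖f z‖ ≤ WienerNorm f := by
  have hz1 : ‖z‖ = 1 := by simpa using hz
  rw [← (hf.2 z hz).tsum_eq]
  have h : ∀ k : ℤ, ‖fcoeff f k * z ^ k‖ = ‖fcoeff f k‖ := fun k => by
    rw [norm_mul, norm_zpow, hz1, one_zpow, mul_one]
  refine (norm_tsum_le_tsum_norm (by simpa only [h] using hf.1)).trans ?_
  simp only [h]; exact le_rfl

theorem fcoeff_add {f g : ℂ → ℂ} (hf : f ∈ WienerAlg) (hg : g ∈ WienerAlg) :
    f + g ∈ WienerAlg ∧ fcoeff (f + g) = fcoeff f + fcoeff g := by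
  have hs : Summable fun k => ‖(fcoeff f + fcoeff g) k‖ :=
    (hf.1.add hg.1).of_nonneg_of_le (fun _ => norm_nonneg _) fun _ => norm_add_le _ _
  have hh : ∀ z ∈ sphere (0 : ℂ) 1,
      HasSum (fun k => (fcoeff f + fcoeff g) k * z ^ k) ((f + g) z) := fun z hz => by
    simpa only [Pi.add_apply, add_mul] using (hf.2 z hz).add (hg.2 z hz)
  exact ⟨mem_wienerAlg_of_hasSum hs hh, fcoeff_eq_of_hasSum hs hh⟩

theorem fcoeff_smul {f : ℂ → ℂ} (a : ℂ) (hf : f ∈ WienerAlg) :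
    a • f ∈ WienerAlg ∧ fcoeff (a • f) = a • fcoeff f := by
  have hs : Summable fun k => ‖(a • fcoeff f) k‖ := by
    simpa only [Pi.smul_apply, norm_smul] using hf.1.mul_left ‖a‖
  have hh : ∀ z ∈ sphere (0 : ℂ) 1,
      HasSum (fun k => (a • fcoeff f) k * z ^ k) ((a • f) z) := fun z hz => by
    simpa only [Pi.smul_apply, smul_eq_mul, mul_assoc] using (hf.2 z hz).mul_left a
  exact ⟨mem_wienerAlg_of_hasSum hs hh, fcoeff_eq_of_hasSum hs hh⟩

theorem fcoeff_zpow (n : ℤ) : (fun z : ℂ => z ^ n) ∈ WienerAlg ∧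
    fcoeff (fun z : ℂ => z ^ n) = Pi.single n 1 := by
  have hs : Summable fun k => ‖(Pi.single n (1 : ℂ) : ℤ → ℂ) k‖ :=
    summable_of_ne_finset_zero (s := {n}) fun k hk => by
      rw [Pi.single_eq_of_ne (by simpa using hk), norm_zero]
  have hh : ∀ z ∈ sphere (0 : ℂ) 1,
      HasSum (fun k => (Pi.single n (1 : ℂ) : ℤ → ℂ) k * z ^ k) (z ^ n) := fun z _ => by
    have := hasSum_single (f := fun k => (Pi.single n (1 : ℂ) : ℤ → ℂ) k * z ^ k) n
      fun k hk => by rw [Pi.single_eq_of_ne hk, zero_mul]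
    simpa using this
  exact ⟨mem_wienerAlg_of_hasSum hs hh, fcoeff_eq_of_hasSum hs hh⟩

theorem wienerNorm_zpow (n : ℤ) : WienerNorm (fun z : ℂ => z ^ n) = 1 := by
  rw [WienerNorm, (fcoeff_zpow n).2, tsum_eq_single n fun k hk => by
    rw [Pi.single_eq_of_ne hk, norm_zero]]
  simp

theorem mul_mem_wienerAlg {f g : ℂ → ℂ} (hf : f ∈ WienerAlg) (hg : g ∈ WienerAlg) :
    f * g ∈ WienerAlg ∧ WienerNorm (f * g) ≤ WienerNorm f * WienerNorm g := by
  set e : ℤ × ℤ ≃ ℤ × ℤ :=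
    { toFun := fun p => (p.1 - p.2, p.2)
      invFun := fun p => (p.1 + p.2, p.2)
      left_inv := fun p => by simp
      right_inv := fun p => by simp } with he
  set a := fcoeff f with ha
  set b := fcoeff g with hb
  have hnn : Summable fun p : ℤ × ℤ => ‖a p.1‖ * ‖b p.2‖ :=
    Summable.mul_of_nonneg (f := fun k => ‖a k‖) (g := fun k => ‖b k‖) hf.1 hg.1
      (fun k => norm_nonneg (a k)) fun k => norm_nonneg (b k)
  have hnn' : HasSum (fun p : ℤ × ℤ => ‖a (p.1 - p.2)‖ * ‖b p.2‖)
      (WienerNorm f * WienerNorm g) := by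
    have h1 : HasSum (fun k => ‖a k‖) (WienerNorm f) := hf.1.hasSum
    have h2 : HasSum (fun k => ‖b k‖) (WienerNorm g) := hg.1.hasSum
    have h3 := (e.hasSum_iff (f := fun p : ℤ × ℤ => ‖a p.1‖ * ‖b p.2‖)).2 (h1.mul h2 hnn)
    exact h3
  have hfib : ∀ n, Summable fun j => ‖a (n - j)‖ * ‖b j‖ := fun n => hnn'.summable.prod_factor n
  have hfib' : ∀ n, Summable fun j => ‖a (n - j) * b j‖ := fun n => by
    simpa only [norm_mul] using hfib n
  set c : ℤ → ℂ := fun n => ∑' j, a (n - j) * b j with hc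
  have hcle : ∀ n, ‖c n‖ ≤ ∑' j, ‖a (n - j)‖ * ‖b j‖ := fun n => by
    simpa only [norm_mul] using norm_tsum_le_tsum_norm (hfib' n)
  have hS : HasSum (fun n => ∑' j, ‖a (n - j)‖ * ‖b j‖) (WienerNorm f * WienerNorm g) :=
    hnn'.prod_fiberwise fun n => (hfib n).hasSum
  have hcs : Summable fun n => ‖c n‖ :=
    hS.summable.of_nonneg_of_le (fun _ => norm_nonneg _) hcle
  have hh : ∀ z ∈ sphere (0 : ℂ) 1, HasSum (fun n => c n * z ^ n) ((f * g) z) := fun z hz => by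
    have hz1 : ‖z‖ = 1 := by simpa using hz
    have hz0 : z ≠ 0 := by rintro rfl; simp at hz1
    have h1 : HasSum (fun p : ℤ × ℤ => (a p.1 * z ^ p.1) * (b p.2 * z ^ p.2)) (f z * g z) := by
      have h2 : Summable fun p : ℤ × ℤ => (a p.1 * z ^ p.1) * (b p.2 * z ^ p.2) := by
        refine Summable.of_norm ?_
        simp only [norm_mul, norm_zpow, hz1, one_zpow, mul_one]
        exact hnn
      exact HasSum.mul (f := fun k => a k * z ^ k) (g := fun k => b k * z ^ k)
        (hf.2 z hz) (hg.2 z hz) h2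
    have h2 := (e.hasSum_iff (f := fun p : ℤ × ℤ => (a p.1 * z ^ p.1) * (b p.2 * z ^ p.2))).2 h1
    refine h2.prod_fiberwise fun n => ?_
    have h3 : HasSum (fun j => a (n - j) * b j) (c n) := (hfib' n).of_norm.hasSum
    have h4 : (fun j => a (n - j) * b j * z ^ n)
        = fun j => a (n - j) * z ^ (n - j) * (b j * z ^ j) := by
      funext j
      rw [mul_mul_mul_comm, ← zpow_add₀ hz0, sub_add_cancel]
    have h5 := h3.mul_right (z ^ n)
    rw [h4] at h5
    exact h5
  refine ⟨mem_wienerAlg_of_hasSum hcs hh, ?_⟩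
  rw [WienerNorm, fcoeff_eq_of_hasSum hcs hh, ← hS.tsum_eq]
  exact hcs.tsum_le_tsum hcle hS.summable

theorem const_mem_wienerAlg (a : ℂ) : (fun _ => a) ∈ WienerAlg := by
  have := (fcoeff_smul a (fcoeff_zpow 0).1).1
  convert this using 1
  funext z; simp

theorem sub_mem_wienerAlg {f g : ℂ → ℂ} (hf : f ∈ WienerAlg) (hg : g ∈ WienerAlg) :
    f - g ∈ WienerAlg := by
  have := (fcoeff_add hf (fcoeff_smul (-1) hg).1).1
  convert this using 1
  funext z; simp [sub_eq_add_neg]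

theorem wienerNorm_add_le {f g : ℂ → ℂ} (hf : f ∈ WienerAlg) (hg : g ∈ WienerAlg) :
    WienerNorm (f + g) ≤ WienerNorm f + WienerNorm g := by
  rw [WienerNorm, (fcoeff_add hf hg).2, WienerNorm, WienerNorm, ← hf.1.tsum_add hg.1]
  refine Summable.tsum_le_tsum (fun k => norm_add_le _ _) ?_ (hf.1.add hg.1)
  have := (fcoeff_add hf hg).1.1
  rwa [(fcoeff_add hf hg).2] at this

theorem wienerNorm_smul {f : ℂ → ℂ} (a : ℂ) (hf : f ∈ WienerAlg) :
    WienerNorm (a • f) = ‖a‖ * WienerNorm f := by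
  rw [WienerNorm, (fcoeff_smul a hf).2, WienerNorm, ← tsum_mul_left]
  simp only [Pi.smul_apply, norm_smul]

end WienerAlgebra

section WienerRing

/-- The Wiener algebra as a subalgebra of the algebra of all functions. -/
def wienerSubalgebra : Subalgebra ℂ (ℂ → ℂ) where
  carrier := WienerAlg
  mul_mem' hf hg := (mul_mem_wienerAlg hf hg).1
  add_mem' hf hg := (fcoeff_add hf hg).1
  algebraMap_mem' a := const_mem_wienerAlg a

/-- The Wiener algebra as a type, to be seminormed by `WienerNorm`. -/
def WienerRing : Type := wienerSubalgebra

instance : CommRing WienerRing := inferInstanceAs (CommRing wienerSubalgebra)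

instance : Algebra ℂ WienerRing := inferInstanceAs (Algebra ℂ wienerSubalgebra)

/-- The underlying function of an element of the Wiener algebra. -/
def WienerRing.toFun : WienerRing →ₐ[ℂ] (ℂ → ℂ) := wienerSubalgebra.val

/-- An element of `WienerAlg` as an element of `WienerRing`. -/
def WienerRing.mk (f : ℂ → ℂ) (hf : f ∈ WienerAlg) : WienerRing := ⟨f, hf⟩

theorem WienerRing.toFun_mk (f : ℂ → ℂ) (hf : f ∈ WienerAlg) :
    WienerRing.toFun (WienerRing.mk f hf) = f := rfl

theorem WienerRing.toFun_mem (f : WienerRing) : WienerRing.toFun f ∈ WienerAlg := Subtype.prop f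

/-- `WienerNorm` as a seminorm on the additive group of the Wiener algebra. -/
def wienerSeminorm : AddGroupSeminorm WienerRing where
  toFun f := WienerNorm (WienerRing.toFun f)
  map_zero' := by
    have h := wienerNorm_smul 0 (const_mem_wienerAlg 0)
    rw [zero_smul, norm_zero, zero_mul] at h
    rw [map_zero]; exact h
  add_le' f g := by
    rw [map_add]; exact wienerNorm_add_le f.toFun_mem g.toFun_mem
  neg' f := by
    have h := wienerNorm_smul (-1) f.toFun_mem
    rw [neg_one_smul, norm_neg, norm_one, one_mul] at h
    rw [map_neg]; exact h

instance : SeminormedAddCommGroup WienerRing := wienerSeminorm.toSeminormedAddCommGroup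

theorem WienerRing.norm_def (f : WienerRing) : ‖f‖ = WienerNorm (WienerRing.toFun f) := rfl

instance : SeminormedCommRing WienerRing :=
  { (inferInstance : SeminormedAddCommGroup WienerRing),
    (inferInstance : CommRing WienerRing) with
    norm_mul_le := fun f g => by
      rw [WienerRing.norm_def, map_mul]
      exact (mul_mem_wienerAlg f.toFun_mem g.toFun_mem).2 }

instance : NormedAlgebra ℂ WienerRing where
  norm_smul_le a f := by
    rw [WienerRing.norm_def, map_smul, wienerNorm_smul a f.toFun_mem]; rfl

theorem WienerRing.norm_sub_eq_zero {f g : WienerRing}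
    (h : ∀ z ∈ sphere (0 : ℂ) 1, f.toFun z = g.toFun z) : ‖f - g‖ = 0 := by
  have h1 : fcoeff (WienerRing.toFun (f - g)) = 0 :=
    fcoeff_eq_of_hasSum (by simp) fun z hz => by
      rw [map_sub, Pi.sub_apply, h z hz, sub_self]; simp
  rw [WienerRing.norm_def, WienerNorm, h1]
  simp

theorem WienerRing.hasSum_fcoeff (f : WienerRing) :
    HasSum (fun k : ℤ => fcoeff f.toFun k • WienerRing.mk _ (fcoeff_zpow k).1) f := by
  classical
  have hf := f.toFun_mem
  rw [HasSum, SummationFilter.unconditional_filter, tendsto_iff_norm_sub_tendsto_zero]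
  refine (tendsto_tsum_compl_atTop_zero fun k => ‖fcoeff f.toFun k‖).congr fun s => ?_
  set c : ℤ → ℂ := fun k => if k ∈ s then 0 else fcoeff f.toFun k with hc
  have hcs : Summable fun k => ‖c k‖ := by
    refine hf.1.of_nonneg_of_le (fun _ => norm_nonneg _) fun k => ?_
    simp only [hc]; split_ifs <;> simp
  have hh : ∀ z ∈ sphere (0 : ℂ) 1, HasSum (fun k => c k * z ^ k)
      (WienerRing.toFun (f - ∑ k ∈ s, fcoeff f.toFun k • WienerRing.mk _ (fcoeff_zpow k).1) z) := by
    intro z hz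
    have h1 : HasSum (fun k => if k ∈ s then fcoeff f.toFun k * z ^ k else 0)
        (∑ k ∈ s, fcoeff f.toFun k * z ^ k) := by
      have h2 := hasSum_sum_of_ne_finset_zero (L := SummationFilter.unconditional ℤ)
        (f := fun k => if k ∈ s then fcoeff f.toFun k * z ^ k else 0) (s := s)
        fun k hk => if_neg hk
      rwa [Finset.sum_congr rfl fun k hk => if_pos hk] at h2
    have h3 := (hf.2 z hz).sub h1
    have h4 : (fun k => fcoeff f.toFun k * z ^ k
        - if k ∈ s then fcoeff f.toFun k * z ^ k else 0) = fun k => c k * z ^ k := by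
      funext k; simp only [hc]; split_ifs <;> simp
    rw [h4] at h3
    have h5 : WienerRing.toFun (f - ∑ k ∈ s, fcoeff f.toFun k • WienerRing.mk _ (fcoeff_zpow k).1)
        = f.toFun - ∑ k ∈ s, fcoeff f.toFun k • fun z : ℂ => z ^ k := by
      rw [map_sub, map_sum]
      simp only [map_smul, WienerRing.toFun_mk]
    rw [h5, Pi.sub_apply, Finset.sum_apply]
    exact h3
  rw [norm_sub_rev, WienerRing.norm_def, WienerNorm, fcoeff_eq_of_hasSum hcs hh]
  refine (tsum_subtype {k : ℤ | k ∉ s} fun k => ‖fcoeff f.toFun k‖).trans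
    (tsum_congr fun k => ?_)
  simp only [hc, indicator_apply, mem_ofPred_eq]
  split_ifs <;> simp_all

end WienerRing

section WienerRing

theorem IsClosedIdealW.zero_mem {J : Set (ℂ → ℂ)} (hJ : IsClosedIdealW J) (hne : J.Nonempty) :
    (0 : ℂ → ℂ) ∈ J := by
  obtain ⟨g, hg⟩ := hne
  have h := hJ.2.2.1 _ (const_mem_wienerAlg 0) g hg
  have h2 : (fun _ => (0 : ℂ)) * g = 0 := by funext z; simp
  rwa [h2] at h

/-- A nonempty closed ideal of the Wiener algebra as an ideal of `WienerRing`. -/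
def IsClosedIdealW.toIdeal {J : Set (ℂ → ℂ)} (hJ : IsClosedIdealW J) (hne : J.Nonempty) :
    Ideal WienerRing where
  carrier := {f | f.toFun ∈ J}
  add_mem' {f g} hf hg := by
    change WienerRing.toFun (f + g) ∈ J
    rw [map_add]; exact hJ.2.1 _ hf _ hg
  zero_mem' := by
    change WienerRing.toFun 0 ∈ J
    rw [map_zero]; exact hJ.zero_mem hne
  smul_mem' c f hf := by
    change WienerRing.toFun (c * f) ∈ J
    rw [map_mul]; exact hJ.2.2.1 _ c.toFun_mem _ hf

/-- The canonical map to the completed quotient of the Wiener algebra by an ideal. -/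
def completedQuotientMk (I : Ideal WienerRing) :
    WienerRing →+* UniformSpace.Completion (WienerRing ⧸ I) :=
  UniformSpace.Completion.coeRingHom.comp (Ideal.Quotient.mk I)

theorem norm_completedQuotientMk_le (I : Ideal WienerRing) (f : WienerRing) :
    ‖completedQuotientMk I f‖ ≤ ‖f‖ :=
  (UniformSpace.Completion.norm_coe _).trans_le (Ideal.Quotient.norm_mk_le I f)

theorem completedQuotientMk_smul (I : Ideal WienerRing) (a : ℂ) (f : WienerRing) :
    completedQuotientMk I (a • f) = a • completedQuotientMk I f :=
  UniformSpace.Completion.coe_smul a (Ideal.Quotient.mk I f)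

theorem completedQuotientMk_eq_of_eqOn (I : Ideal WienerRing) {f g : WienerRing}
    (h : ∀ z ∈ sphere (0 : ℂ) 1, f.toFun z = g.toFun z) :
    completedQuotientMk I f = completedQuotientMk I g := by
  rw [← sub_eq_zero, ← map_sub, ← norm_le_zero_iff, ← WienerRing.norm_sub_eq_zero h]
  exact norm_completedQuotientMk_le I _

/-- The powers of the coordinate function in the completed quotient. -/
def coordinatePowers (I : Ideal WienerRing) :
    Multiplicative ℤ →* UniformSpace.Completion (WienerRing ⧸ I) where
  toFun k := completedQuotientMk I (WienerRing.mk _ (fcoeff_zpow k.toAdd).1)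
  map_one' := by
    rw [← map_one (completedQuotientMk I)]
    refine completedQuotientMk_eq_of_eqOn I fun z _ => ?_
    rw [map_one WienerRing.toFun, WienerRing.toFun_mk]; simp
  map_mul' j k := by
    rw [← map_mul]
    refine completedQuotientMk_eq_of_eqOn I fun z hz => ?_
    have hz0 : z ≠ 0 := by rintro rfl; simp at hz
    rw [map_mul WienerRing.toFun, WienerRing.toFun_mk, Pi.mul_apply,
      WienerRing.toFun_mk, WienerRing.toFun_mk]
    exact zpow_add₀ hz0 _ _

/-- The coordinate function as a unit of the completed quotient. -/
def coordinateUnit (I : Ideal WienerRing) : (UniformSpace.Completion (WienerRing ⧸ I))ˣ :=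
  (coordinatePowers I).toHomUnits (Multiplicative.ofAdd 1)

theorem coordinateUnit_zpow (I : Ideal WienerRing) (k : ℤ) :
    ((coordinateUnit I ^ k : (UniformSpace.Completion (WienerRing ⧸ I))ˣ) :
      UniformSpace.Completion (WienerRing ⧸ I))
    = completedQuotientMk I (WienerRing.mk _ (fcoeff_zpow k).1) := by
  rw [coordinateUnit, ← map_zpow, ← ofAdd_zsmul, smul_eq_mul, mul_one]
  rfl

theorem norm_coordinateUnit_zpow_le (I : Ideal WienerRing) (k : ℤ) :
    ‖((coordinateUnit I ^ k : (UniformSpace.Completion (WienerRing ⧸ I))ˣ) :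
      UniformSpace.Completion (WienerRing ⧸ I))‖ ≤ 1 := by
  rw [coordinateUnit_zpow]
  refine (norm_completedQuotientMk_le I _).trans ?_
  rw [WienerRing.norm_def, WienerRing.toFun_mk, wienerNorm_zpow]

theorem hasSum_coordinateUnit (I : Ideal WienerRing) (f : WienerRing) :
    HasSum (fun k : ℤ => fcoeff f.toFun k •
      ((coordinateUnit I ^ k : (UniformSpace.Completion (WienerRing ⧸ I))ˣ) :
        UniformSpace.Completion (WienerRing ⧸ I))) (completedQuotientMk I f) := by
  have hcont : Continuous (completedQuotientMk I) :=
    (AddMonoidHomClass.lipschitz_of_bound (completedQuotientMk I) 1 fun f => by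
      rw [one_mul]; exact norm_completedQuotientMk_le I f).continuous
  have h := f.hasSum_fcoeff.map (completedQuotientMk I) hcont
  simpa only [Function.comp_def, completedQuotientMk_smul, ← coordinateUnit_zpow] using h

open WeakDual in
theorem norm_character_coordinateUnit (I : Ideal WienerRing)
    (χ : characterSpace ℂ (UniformSpace.Completion (WienerRing ⧸ I))) :
    ‖χ (coordinateUnit I : UniformSpace.Completion (WienerRing ⧸ I))‖ = 1 := by
  have h0 : ‖(1 : UniformSpace.Completion (WienerRing ⧸ I))‖ ≤ 1 := by
    simpa using norm_coordinateUnit_zpow_le I 0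
  have h1 : ‖χ (coordinateUnit I : UniformSpace.Completion (WienerRing ⧸ I))‖ ≤ 1 := by
    have := norm_coordinateUnit_zpow_le I 1
    rw [zpow_one] at this
    exact (norm_character_le h0 χ _).trans this
  have h2 := (norm_character_le h0 χ _).trans (norm_coordinateUnit_zpow_le I (-1))
  rw [character_zpow, zpow_neg_one, norm_inv] at h2
  have hne : χ (coordinateUnit I : UniformSpace.Completion (WienerRing ⧸ I)) ≠ 0 := by
    intro h
    have h3 := congrArg χ (coordinateUnit I).mul_inv
    rw [map_mul, h, zero_mul, map_one] at h3
    exact zero_ne_one h3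
  exact le_antisymm h1 ((inv_le_one₀ (norm_pos_iff.2 hne)).1 h2)

open WeakDual in
theorem character_completedQuotientMk (I : Ideal WienerRing)
    (χ : characterSpace ℂ (UniformSpace.Completion (WienerRing ⧸ I))) (f : WienerRing) :
    χ (completedQuotientMk I f)
      = f.toFun (χ (coordinateUnit I : UniformSpace.Completion (WienerRing ⧸ I))) := by
  have h := (hasSum_coordinateUnit I f).map χ (map_continuous χ)
  have h2 := f.toFun_mem.2 _ (mem_sphere_zero_iff_norm.2 (norm_character_coordinateUnit I χ))
  refine h.unique ?_
  simpa only [Function.comp_def, map_smul, character_zpow, smul_eq_mul] using h2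

theorem completedQuotientMk_eq_zero_iff {J : Set (ℂ → ℂ)} (hJ : IsClosedIdealW J)
    (hne : J.Nonempty) (f : WienerRing) :
    completedQuotientMk (hJ.toIdeal hne) f = 0 ↔ f.toFun ∈ J := by
  constructor
  · intro h
    have h1 : ‖Ideal.Quotient.mk (hJ.toIdeal hne) f‖ = 0 := by
      have := congrArg norm h
      rw [norm_zero] at this
      rwa [← UniformSpace.Completion.norm_coe]
    refine hJ.2.2.2 _ f.toFun_mem fun ε hε => ?_
    obtain ⟨m, hm, hmε⟩ := Ideal.Quotient.norm_mk_lt (Ideal.Quotient.mk (hJ.toIdeal hne) f) hε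
    rw [h1, zero_add] at hmε
    have h2 : f - m ∈ hJ.toIdeal hne := by
      rw [← Ideal.Quotient.eq]; exact hm.symm
    refine ⟨_, h2, ?_⟩
    rw [map_sub, sub_sub_cancel]
    exact hmε
  · intro h
    have h1 : Ideal.Quotient.mk (hJ.toIdeal hne) f = 0 := Ideal.Quotient.eq_zero_iff_mem.2 h
    change ((Ideal.Quotient.mk (hJ.toIdeal hne) f : WienerRing ⧸ hJ.toIdeal hne) :
      UniformSpace.Completion (WienerRing ⧸ hJ.toIdeal hne)) = 0
    rw [h1]; rfl

open WeakDual in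
/-- Functions of the Wiener algebra vanishing on a Kronecker set `K` vanish in the completed
quotient by an ideal if all characters of that quotient are evaluations at points of `K`. -/
theorem completedQuotientMk_eq_zero_of_kronecker {K : Set ℂ} (hK : IsKronecker K)
    (I : Ideal WienerRing)
    (hχ : ∀ χ : characterSpace ℂ (UniformSpace.Completion (WienerRing ⧸ I)),
      χ (coordinateUnit I : UniformSpace.Completion (WienerRing ⧸ I)) ∈ K)
    (f : WienerRing) (hf : ∀ z ∈ K, f.toFun z = 0) : completedQuotientMk I f = 0 := by
  have h1 := f.toFun_mem.1
  have h2 : ∀ z ∈ K, HasSum (fun k : ℤ => fcoeff f.toFun k * z ^ k) 0 := fun z hz => by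
    rw [← hf z hz]
    exact f.toFun_mem.2 z (hK.2.1 hz)
  exact hasSum_zero_of_kronecker hK (coordinateUnit I) (norm_coordinateUnit_zpow_le I)
    hχ h1 h2 (hasSum_coordinateUnit I f)

/-- Kronecker sets are sets of spectral synthesis: a closed ideal with no common zero on the
circle outside `K` contains every function vanishing on `K`. -/
theorem mem_of_isClosedIdealW {K : Set ℂ} (hK : IsKronecker K) {J : Set (ℂ → ℂ)}
    (hJ : IsClosedIdealW J) (hne : J.Nonempty)
    (hsep : ∀ w ∈ sphere (0 : ℂ) 1, w ∉ K → ∃ F ∈ J, F w ≠ 0) {f : ℂ → ℂ} (hf : f ∈ WienerAlg)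
    (hfK : ∀ z ∈ K, f z = 0) : f ∈ J := by
  rw [← WienerRing.toFun_mk f hf, ← completedQuotientMk_eq_zero_iff hJ hne]
  refine completedQuotientMk_eq_zero_of_kronecker hK _ (fun χ => ?_) _ hfK
  by_contra hχ
  obtain ⟨F, hF, hFw⟩ := hsep _
    (mem_sphere_zero_iff_norm.2 (norm_character_coordinateUnit _ χ)) hχ
  have h := (completedQuotientMk_eq_zero_iff hJ hne (WienerRing.mk F (hJ.1 hF))).2 hF
  have h2 := character_completedQuotientMk _ χ (WienerRing.mk F (hJ.1 hF))
  rw [h, map_zero] at h2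
  exact hFw h2.symm

end WienerRing

section APlus

theorem taylorCoeff_eq_of_hasSum {f : ℂ → ℂ} {a : ℕ → ℂ}
    (hf : ∀ z ∈ closedBall (0 : ℂ) 1, HasSum (fun n => a n * z ^ n) (f z)) :
    taylorCoeff f = a := by
  have h1 : HasFPowerSeriesAt f (FormalMultilinearSeries.ofScalars ℂ a) 0 := by
    rw [hasFPowerSeriesAt_iff]
    filter_upwards [closedBall_mem_nhds (0 : ℂ) one_pos] with z hz
    simpa [mul_comm] using hf z hz
  have h2 := h1.eq_formalMultilinearSeries h1.analyticAt.hasFPowerSeriesAt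
  funext n
  have h3 := congrArg (fun p => FormalMultilinearSeries.coeff p n) h2
  simpa [taylorCoeff] using h3.symm

theorem APlus.hasSum {f : ℂ → ℂ} (hf : f ∈ APlus) {z : ℂ} (hz : z ∈ closedBall (0 : ℂ) 1) :
    HasSum (fun n => taylorCoeff f n * z ^ n) (f z) := by
  obtain ⟨a, _, h⟩ := hf
  rw [taylorCoeff_eq_of_hasSum h]
  exact h z hz

theorem APlus.summable {f : ℂ → ℂ} (hf : f ∈ APlus) : Summable fun n => ‖taylorCoeff f n‖ := by
  obtain ⟨a, ha, h⟩ := hf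
  rwa [taylorCoeff_eq_of_hasSum h]

theorem norm_mul_pow_le_of_mem_closedBall (a : ℂ) {z : ℂ} (hz : z ∈ closedBall (0 : ℂ) 1)
    (n : ℕ) : ‖a * z ^ n‖ ≤ ‖a‖ := by
  rw [norm_mul, norm_pow]
  exact mul_le_of_le_one_right (norm_nonneg _)
    (pow_le_one₀ (norm_nonneg _) (mem_closedBall_zero_iff.1 hz))

theorem APlus.norm_le {f : ℂ → ℂ} (hf : f ∈ APlus) {z : ℂ} (hz : z ∈ closedBall (0 : ℂ) 1) :
    ‖f z‖ ≤ APlusNorm f := by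
  rw [← (APlus.hasSum hf hz).tsum_eq]
  exact tsum_of_norm_bounded (APlus.summable hf).hasSum fun n =>
    norm_mul_pow_le_of_mem_closedBall _ hz n

theorem APlus.sub_mem {f g : ℂ → ℂ} (hf : f ∈ APlus) (hg : g ∈ APlus) : f - g ∈ APlus := by
  obtain ⟨a, ha, hfa⟩ := hf
  obtain ⟨b, hb, hgb⟩ := hg
  refine ⟨a - b, (ha.add hb).of_nonneg_of_le (fun _ => norm_nonneg _) fun n => norm_sub_le _ _,
    fun z hz => ?_⟩
  simpa only [Pi.sub_apply, sub_mul] using (hfa z hz).sub (hgb z hz)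

theorem APlus.differentiableOn {f : ℂ → ℂ} (hf : f ∈ APlus) :
    DifferentiableOn ℂ f (ball (0 : ℂ) 1) :=
  (differentiableOn_tsum_of_summable_norm (F := fun n z => taylorCoeff f n * z ^ n)
    (APlus.summable hf) (fun n => by fun_prop) isOpen_ball fun n w hw =>
      norm_mul_pow_le_of_mem_closedBall _ (ball_subset_closedBall hw) n).congr fun z hz =>
    (APlus.hasSum hf (ball_subset_closedBall hz)).tsum_eq.symm

theorem APlus.mem_hinf {f : ℂ → ℂ} (hf : f ∈ APlus) : f ∈ Hinf :=
  ⟨APlus.differentiableOn hf, APlusNorm f, fun _ hz =>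
    APlus.norm_le hf (ball_subset_closedBall hz)⟩

theorem APlus.mem_wienerAlg {f : ℂ → ℂ} (hf : f ∈ APlus) : f ∈ WienerAlg := by
  have hinj : Function.Injective ((↑) : ℕ → ℤ) := Nat.cast_injective
  refine mem_wienerAlg_of_hasSum
    (c := Function.extend ((↑) : ℕ → ℤ) (taylorCoeff f) 0) ?_ fun z hz => ?_
  · rw [← hinj.summable_iff]
    · simpa [Function.comp_def, hinj.extend_apply] using APlus.summable hf
    · intro k hk
      rw [Function.extend_apply' _ _ _ hk]
      simp
  · rw [← hinj.hasSum_iff]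
    · simpa [Function.comp_def, hinj.extend_apply] using
        APlus.hasSum hf (sphere_subset_closedBall hz)
    · intro k hk
      rw [Function.extend_apply' _ _ _ hk]
      simp

theorem aPlusNorm_zero : APlusNorm 0 = 0 := by
  have h : ∀ z ∈ closedBall (0 : ℂ) 1,
      HasSum (fun n => (0 : ℕ → ℂ) n * z ^ n) ((0 : ℂ → ℂ) z) := fun z _ => by
    simp
  rw [APlusNorm, taylorCoeff_eq_of_hasSum h]
  simp

theorem J0Plus.eq_zero {E : Set ℂ} (hE : E ⊆ sphere (0 : ℂ) 1) {f : ℂ → ℂ} (hf : f ∈ J0Plus E)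
    {z : ℂ} (hz : z ∈ E) : f z = 0 := by
  rw [← norm_le_zero_iff]
  refine le_of_forall_pos_le_add fun ε hε => ?_
  obtain ⟨g, hg, hgE, hfg⟩ := hf.2 ε hε
  have h := APlus.norm_le (APlus.sub_mem hf.1 hg) (sphere_subset_closedBall (hE hz))
  rw [Pi.sub_apply, hgE.2.2.1 z hz, sub_zero] at h
  linarith

theorem norm_iteratedDeriv_zero_le {f : ℂ → ℂ} (hf : DifferentiableOn ℂ f (ball (0 : ℂ) 1))
    {M : ℝ} (hM : ∀ z ∈ ball (0 : ℂ) 1, ‖f z‖ ≤ M) (n : ℕ) :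
    ‖iteratedDeriv n f 0‖ ≤ n.factorial * M := by
  have h1 : ∀ r ∈ Ioo (0 : ℝ) 1, ‖iteratedDeriv n f 0‖ * r ^ n ≤ n.factorial * M := by
    intro r hr
    have h := norm_iteratedDeriv_le_of_forall_mem_sphere_norm_le n hr.1 (c := 0) (C := M) (f := f)
      (DifferentiableOn.diffContOnCl (hf.mono (closure_ball_subset_closedBall.trans
        (closedBall_subset_ball hr.2)))) fun z hz => hM z
          (sphere_subset_ball hr.2 hz)
    rwa [le_div_iff₀ (pow_pos hr.1 n)] at h
  have h2 : Tendsto (fun r : ℝ => ‖iteratedDeriv n f 0‖ * r ^ n) (nhdsWithin 1 (Iio 1))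
      (nhds (‖iteratedDeriv n f 0‖ * 1 ^ n)) :=
    (Continuous.tendsto (by fun_prop) 1).mono_left nhdsWithin_le_nhds
  rw [one_pow, mul_one] at h2
  exact le_of_tendsto h2 (eventually_of_mem (Ioo_mem_nhdsLT one_pos) h1)

theorem VanishAllDeriv.mem_aPlus {E : Set ℂ} {f : ℂ → ℂ} (hf : VanishAllDeriv E f) :
    f ∈ APlus := by
  obtain ⟨g, hgc, hg, -⟩ := hf.2.2.2 2
  obtain ⟨M, hM⟩ := (ProperSpace.isCompact_closedBall (0 : ℂ) 1).exists_bound_of_continuousOn hgc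
  have hM0 : 0 ≤ M := (norm_nonneg _).trans (hM 0 (by simp))
  have hd : DifferentiableOn ℂ (iteratedDeriv 2 f) (ball (0 : ℂ) 1) := by
    rw [iteratedDeriv_succ, iteratedDeriv_one]
    exact (hf.2.1.deriv isOpen_ball).deriv isOpen_ball
  have hb : ∀ n : ℕ, ‖taylorCoeff f (n + 2)‖ ≤ M * (1 / ((n : ℝ) + 1) ^ 2) := by
    intro n
    have h1 := norm_iteratedDeriv_zero_le hd (M := M) (fun z hz => by
      rw [← hg hz]; exact hM z (ball_subset_closedBall hz)) n
    have h2 : iteratedDeriv n (iteratedDeriv 2 f) = iteratedDeriv (n + 2) f := by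
      simp only [iteratedDeriv_eq_iterate, Function.iterate_add_apply]
    rw [h2] at h1
    have hn : (0 : ℝ) < n.factorial := by positivity
    rw [taylorCoeff, norm_div, Complex.norm_natCast, Nat.factorial_succ, Nat.factorial_succ,
      div_le_iff₀ (by positivity)]
    push_cast
    calc _ ≤ _ := h1
      _ ≤ n.factorial * M * (((n : ℝ) + 1 + 1) / (n + 1)) :=
        le_mul_of_one_le_right (by positivity) ((one_le_div (by positivity)).2 (by linarith))
      _ = _ := by field_simp
  have hs : Summable fun n => ‖taylorCoeff f n‖ := by
    rw [← summable_nat_add_iff 2]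
    refine Summable.of_nonneg_of_le (fun _ => norm_nonneg _) hb (Summable.mul_left M ?_)
    have := (summable_nat_add_iff 1).2 (Real.summable_one_div_nat_pow.2 one_lt_two)
    simpa using this
  have hsum : ∀ z ∈ closedBall (0 : ℂ) 1, Summable fun n => taylorCoeff f n * z ^ n :=
    fun z hz => Summable.of_norm_bounded hs fun n => norm_mul_pow_le_of_mem_closedBall _ hz n
  refine ⟨taylorCoeff f, hs, fun z hz => ?_⟩
  have hc : ContinuousOn (fun z => ∑' n, taylorCoeff f n * z ^ n) (closedBall (0 : ℂ) 1) :=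
    continuousOn_tsum (fun n => by fun_prop) hs fun n z hz =>
      norm_mul_pow_le_of_mem_closedBall _ hz n
  have heq : EqOn (fun z => ∑' n, taylorCoeff f n * z ^ n) f (ball (0 : ℂ) 1) := by
    intro z hz
    have h := Complex.hasSum_taylorSeries_on_ball hf.2.1 hz
    have h2 : (fun n => taylorCoeff f n * z ^ n) =
        fun n : ℕ => (n.factorial : ℂ)⁻¹ • (z - 0) ^ n • iteratedDeriv n f 0 := by
      funext n
      rw [taylorCoeff, sub_zero, smul_eq_mul, smul_eq_mul]
      ring
    rw [← h2] at h
    exact h.tsum_eq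
  have := heq.of_subset_closure hc hf.1 ball_subset_closedBall
    (closure_ball (0 : ℂ) one_ne_zero).ge
  rw [← this hz]
  exact (hsum z hz).hasSum

theorem VanishAllDeriv.mem_j0Plus {E : Set ℂ} {f : ℂ → ℂ} (hf : VanishAllDeriv E f) :
    f ∈ J0Plus E :=
  ⟨hf.mem_aPlus, fun ε hε => ⟨f, hf.mem_aPlus, hf, by
    rwa [sub_self, aPlusNorm_zero]⟩⟩

theorem isClosedIdealW_setOf_eq_zero {E : Set ℂ} (hE : E ⊆ sphere (0 : ℂ) 1) :
    IsClosedIdealW {f ∈ WienerAlg | ∀ z ∈ E, f z = 0} := by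
  refine ⟨fun f hf => hf.1, fun f hf g hg => ⟨(fcoeff_add hf.1 hg.1).1, fun z hz => ?_⟩,
    fun f hf g hg => ⟨(mul_mem_wienerAlg hf hg.1).1, fun z hz => ?_⟩,
    fun f hf h => ⟨hf, fun z hz => ?_⟩⟩
  · rw [Pi.add_apply, hf.2 z hz, hg.2 z hz, add_zero]
  · rw [Pi.mul_apply, hg.2 z hz, mul_zero]
  · rw [← norm_le_zero_iff]
    refine le_of_forall_pos_le_add fun ε hε => ?_
    obtain ⟨g, hg, hfg⟩ := h ε hε
    have h := norm_le_wienerNorm (sub_mem_wienerAlg hf hg.1) (hE hz)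
    rw [Pi.sub_apply, hg.2 z hz, sub_zero] at h
    linarith

end APlus

section InnerGcd

theorem circleMap_zero_mem_ball {r : ℝ} (hr : r ∈ Ioo (0 : ℝ) 1) (θ : ℝ) :
    circleMap 0 r θ ∈ ball (0 : ℂ) 1 := by
  rw [mem_ball_zero_iff, norm_circleMap_zero, abs_of_pos hr.1]
  exact hr.2

theorem norm_apply_zero_le_one {S g : ℂ → ℂ} (hS : IsInnerFunction S) (hg : g ∈ Hinf)
    (h : ∀ z ∈ ball (0 : ℂ) 1, ‖S z * g z‖ ≤ 1) : ‖g 0‖ ≤ 1 := by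
  obtain ⟨hgd, C, hC⟩ := hg
  have hC0 : 0 ≤ C := (norm_nonneg _).trans (hC 0 (by simp))
  have hcont : ∀ r ∈ Ioo (0 : ℝ) 1, Continuous fun θ : ℝ => ‖S (circleMap 0 r θ)‖ := fun r hr =>
    (hS.1.continuousOn.comp_continuous (continuous_circleMap 0 r)
      (circleMap_zero_mem_ball hr)).norm
  have hev : ∀ᶠ r : ℝ in nhdsWithin 1 (Iio 1), r ∈ Ioo (0 : ℝ) 1 := Ioo_mem_nhdsLT one_pos
  have h1 : ∀ r ∈ Ioo (0 : ℝ) 1, 2 * Real.pi * ‖g 0‖ ≤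
      ∫ θ in (0 : ℝ)..(2 * Real.pi), (1 + C * (1 - ‖S (circleMap 0 r θ)‖)) := by
    intro r hr
    have hd : DiffContOnCl ℂ g (ball 0 |r|) := by
      rw [abs_of_pos hr.1]
      exact DifferentiableOn.diffContOnCl (hgd.mono (closure_ball_subset_closedBall.trans
        (closedBall_subset_ball hr.2)))
    have h2 := hd.circleAverage
    rw [Real.circleAverage_def] at h2
    rw [← h2, norm_smul, Real.norm_of_nonneg (by positivity), ← mul_assoc,
      mul_inv_cancel₀ (by positivity), one_mul]
    refine intervalIntegral.norm_integral_le_of_norm_le (by positivity)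
      (ae_of_all _ fun θ _ => ?_) ?_
    · have hz := circleMap_zero_mem_ball hr θ
      have h3 := h _ hz
      rw [norm_mul] at h3
      nlinarith [hC _ hz, hS.2.1 _ hz]
    · exact (by have := hcont r hr; fun_prop : Continuous _).intervalIntegrable _ _
  have h2 : Tendsto (fun r : ℝ => ∫ θ in (0 : ℝ)..(2 * Real.pi),
      (1 + C * (1 - ‖S (circleMap 0 r θ)‖))) (nhdsWithin 1 (Iio 1))
      (nhds (∫ _ in (0 : ℝ)..(2 * Real.pi), (1 + C * (1 - (1 : ℝ))))) := by
    refine intervalIntegral.tendsto_integral_filter_of_dominated_convergence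
      (fun _ => 1 + C) ?_ ?_ (by simp) ?_
    · filter_upwards [hev] with r hr
      exact (by have := hcont r hr; fun_prop : Continuous _).aestronglyMeasurable
    · filter_upwards [hev] with r hr
      refine ae_of_all _ fun θ _ => ?_
      have h3 := hS.2.1 _ (circleMap_zero_mem_ball hr θ)
      have h4 := norm_nonneg (S (circleMap 0 r θ))
      rw [Real.norm_of_nonneg (by nlinarith)]
      nlinarith
    · have h3 := hS.2.2
      rw [ae_restrict_iff' measurableSet_Ioc] at h3
      rw [uIoc_of_le (by positivity)]
      filter_upwards [h3] with θ h4 hθ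
      simp only [circleMap, zero_add]
      exact ((h4 hθ).const_sub 1).const_mul C |>.const_add 1
  have h3 := ge_of_tendsto h2 (hev.mono h1)
  simp only [sub_self, mul_zero, add_zero, intervalIntegral.integral_const, sub_zero,
    smul_eq_mul, mul_one] at h3
  exact le_of_mul_le_mul_left (by linarith) (by positivity : 0 < 2 * Real.pi)

/-- The greatest common inner divisor is trivial if the set contains functions bounded by `1`
with value at `0` arbitrarily close to the unit circle. -/
theorem isGcdInner_one {J : Set (ℂ → ℂ)} (hJ : J ⊆ Hinf)
    (h : ∀ ε > 0, ∃ F ∈ J, (∀ z ∈ ball (0 : ℂ) 1, ‖F z‖ ≤ 1) ∧ 1 - ε < ‖F 0‖) :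
    IsGcdInner J fun _ => 1 := by
  refine ⟨⟨differentiableOn_const _, fun _ _ => by simp, ae_of_all _ fun _ => by simp⟩,
    fun f hf _ => ⟨f, hJ hf, fun z _ => (one_mul _).symm⟩, fun S hS hdiv => ?_⟩
  have h0 : (0 : ℂ) ∈ ball (0 : ℂ) 1 := by simp
  have h1 : 1 ≤ ‖S 0‖ := by
    refine le_of_forall_pos_lt_add fun ε hε => ?_
    obtain ⟨F, hF, hF1, hF0⟩ := h (min ε 1) (by positivity)
    have hne : F 0 ≠ 0 := by
      intro h2
      rw [h2, norm_zero] at hF0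
      linarith [min_le_right ε 1]
    obtain ⟨g, hg, hFg⟩ := hdiv F hF ⟨0, h0, hne⟩
    have h2 := norm_apply_zero_le_one hS hg fun z hz => by rw [← hFg z hz]; exact hF1 z hz
    rw [hFg 0 h0, norm_mul] at hF0
    nlinarith [norm_nonneg (S 0), min_le_left ε 1]
  have hmax : IsMaxOn (norm ∘ S) (ball (0 : ℂ) 1) 0 := fun z hz => (hS.2.1 z hz).trans h1
  have hconst := eqOn_of_isPreconnected_of_isMaxOn_norm (convex_ball _ _).isPreconnected
    isOpen_ball hS.1 h0 hmax
  refine ⟨fun _ => (S 0)⁻¹, ⟨differentiableOn_const _, ‖(S 0)⁻¹‖, fun _ _ => le_rfl⟩,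
    fun z hz => ?_⟩
  have hne : S 0 ≠ 0 := norm_pos_iff.1 (one_pos.trans_le h1)
  rw [hconst hz, Function.const_apply, mul_inv_cancel₀ hne]

end InnerGcd

section KroneckerNull

theorem norm_pow_sub_one_le_mul {w : ℂ} (hw : ‖w‖ = 1) (j : ℕ) :
    ‖w ^ j - 1‖ ≤ j * ‖w - 1‖ := by
  induction j with
  | zero => simp
  | succ j ih =>
    have h : w ^ (j + 1) - 1 = w * (w ^ j - 1) + (w - 1) := by ring
    rw [h]
    refine (norm_add_le _ _).trans ?_
    rw [norm_mul, hw, one_mul]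
    push_cast
    linarith

theorem integral_norm_sq_sum_exp {n : ℕ} (hn : 0 < n) (N : ℕ) :
    (∫ θ in (-Real.pi)..Real.pi, ‖∑ j ∈ Finset.range N, (exp (θ * I) ^ n) ^ j‖ ^ 2)
      = 2 * Real.pi * N := by
  have hexp : ∀ (θ : ℝ) (j k : ℕ), (exp (θ * I) ^ n) ^ j * (starRingEnd ℂ) ((exp (θ * I) ^ n) ^ k)
      = exp (((n * j - n * k : ℤ) : ℂ) * I * θ) := by
    intro θ j k
    rw [← pow_mul, ← pow_mul, ← exp_nat_mul, ← exp_nat_mul, ← exp_conj, ← exp_add]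
    congr 1
    simp only [map_mul, conj_I, conj_ofReal, map_natCast]
    push_cast
    ring
  have hper : ∀ m : ℤ, (∫ θ in (-Real.pi)..Real.pi, exp ((m : ℂ) * I * θ))
      = if m = 0 then 2 * Real.pi else 0 := by
    intro m
    have hp : Function.Periodic (fun θ : ℝ => exp ((m : ℂ) * I * θ)) (2 * Real.pi) := by
      intro θ
      have h := (exp_periodic.int_mul m) ((m : ℂ) * I * θ)
      simp only at h ⊢
      rw [← h]
      congr 1
      push_cast
      ring
    have h := hp.intervalIntegral_add_eq (-Real.pi) 0
    rw [show -Real.pi + 2 * Real.pi = Real.pi by ring, zero_add] at h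
    rw [h, integral_exp_int_mul]
  have h : ((∫ θ in (-Real.pi)..Real.pi,
      ‖∑ j ∈ Finset.range N, (exp (θ * I) ^ n) ^ j‖ ^ 2 : ℝ) : ℂ) = (2 * Real.pi * N : ℝ) := by
    rw [← intervalIntegral.integral_ofReal]
    have h1 : ∀ θ : ℝ, ((‖∑ j ∈ Finset.range N, (exp (θ * I) ^ n) ^ j‖ ^ 2 : ℝ) : ℂ)
        = ∑ j ∈ Finset.range N, ∑ k ∈ Finset.range N,
          exp (((n * j - n * k : ℤ) : ℂ) * I * θ) := by
      intro θ
      rw [ofReal_pow, ← mul_conj', map_sum, Finset.sum_mul_sum]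
      simp only [hexp]
    simp only [h1]
    rw [intervalIntegral.integral_finsetSum fun j _ =>
      (by fun_prop : Continuous _).intervalIntegrable _ _]
    have h2 : ∀ j ∈ Finset.range N, (∫ θ in (-Real.pi)..Real.pi, ∑ k ∈ Finset.range N,
        exp (((n * j - n * k : ℤ) : ℂ) * I * θ)) = 2 * Real.pi := by
      intro j hj
      rw [intervalIntegral.integral_finsetSum fun k _ =>
        (by fun_prop : Continuous _).intervalIntegrable _ _]
      simp only [hper]
      rw [Finset.sum_eq_single j]
      · simp
      · intro k _ hkj
        rw [if_neg, ofReal_zero]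
        rw [← mul_sub, mul_eq_zero, not_or]
        exact ⟨by exact_mod_cast hn.ne', by rw [sub_eq_zero]; exact_mod_cast hkj.symm⟩
      · exact fun h => absurd hj h
    rw [Finset.sum_congr rfl h2]
    simp [mul_comm]
  exact_mod_cast h

/-- Kronecker sets have measure zero. -/
theorem IsKronecker.ae_notMem {K : Set ℂ} (hK : IsKronecker K) :
    ∀ᵐ θ : ℝ ∂volume.restrict (Ioc (-Real.pi) Real.pi), exp (θ * I) ∉ K := by
  set μ : Measure ℝ := volume.restrict (Ioc (-Real.pi) Real.pi) with hμ
  have hbound : ∀ N : ℕ, 0 < N → μ.real {θ : ℝ | exp (θ * I) ∈ K} ≤ 8 * Real.pi / N := by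
    intro N hN
    have hN' : (0 : ℝ) < N := by exact_mod_cast hN
    obtain ⟨n, hn, hnK⟩ := hK.exists_pow_near_one (ρ := 1 / (2 * N)) (by positivity)
    have hsub : {θ : ℝ | exp (θ * I) ∈ K} ⊆
        {θ : ℝ | ((N : ℝ) / 2) ^ 2 ≤ ‖∑ j ∈ Finset.range N, (exp (θ * I) ^ n) ^ j‖ ^ 2} := by
      intro θ hθ
      have h1 := hnK _ hθ
      have hw : ‖exp (θ * I) ^ n‖ = 1 := by rw [norm_pow, hK.norm_eq_one hθ, one_pow]
      rw [mem_ofPred_eq]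
      gcongr
      generalize exp (θ * I) ^ n = w at *
      have h2 : ‖∑ j ∈ Finset.range N, (w ^ j - 1)‖ ≤ ∑ j ∈ Finset.range N, (1 / 2 : ℝ) := by
        refine norm_sum_le_of_le _ fun j hj => (norm_pow_sub_one_le_mul hw j).trans ?_
        have hj' : (j : ℝ) ≤ N := by exact_mod_cast (Finset.mem_range.1 hj).le
        calc (j : ℝ) * ‖w - 1‖ ≤ N * (1 / (2 * N)) := by gcongr
          _ = 1 / 2 := by field_simp
      rw [Finset.sum_sub_distrib] at h2
      simp only [Finset.sum_const, Finset.card_range, nsmul_eq_mul, mul_one] at h2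
      have h3 := norm_sub_norm_le (N : ℂ) (∑ j ∈ Finset.range N, w ^ j)
      rw [Complex.norm_natCast, norm_sub_rev] at h3
      linarith
    have hcont : Continuous fun θ : ℝ =>
        ‖∑ j ∈ Finset.range N, (exp (θ * I) ^ n) ^ j‖ ^ 2 := by fun_prop
    have h4 := mul_meas_ge_le_integral_of_nonneg (μ := μ)
      (ae_of_all _ fun θ : ℝ => sq_nonneg ‖∑ j ∈ Finset.range N, (exp (θ * I) ^ n) ^ j‖)
      ((hcont.intervalIntegrable (-Real.pi) Real.pi).1) (((N : ℝ) / 2) ^ 2)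
    rw [hμ, ← intervalIntegral.integral_of_le (by linarith [Real.pi_pos]),
      integral_norm_sq_sum_exp hn, ← hμ] at h4
    have h5 := measureReal_mono (μ := μ) hsub
    rw [le_div_iff₀ hN']
    have h6 : ((N : ℝ) / 2) ^ 2 * μ.real {θ : ℝ | exp (θ * I) ∈ K} ≤ 2 * Real.pi * N :=
      (mul_le_mul_of_nonneg_left h5 (by positivity)).trans h4
    nlinarith
  have hzero : μ.real {θ : ℝ | exp (θ * I) ∈ K} ≤ 0 := by
    have h : Tendsto (fun N : ℕ => 8 * Real.pi / (N : ℝ)) atTop (nhds 0) :=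
      tendsto_const_div_atTop_nhds_zero_nat _
    exact ge_of_tendsto h (eventually_atTop.2 ⟨1, fun N hN => hbound N hN⟩)
  rw [ae_iff]
  simp only [not_not]
  have h := le_antisymm hzero measureReal_nonneg
  rwa [measureReal_eq_zero_iff] at h

end KroneckerNull

section DeLaValleePoussin

/-- De la Vallée-Poussin: an integrable function is dominated, with arbitrarily large constants,
by some integrable function. -/
theorem exists_integrable_superlinear {α : Type*} {_ : MeasurableSpace α} {μ : Measure α}
    {L : α → ℝ} (hL : Integrable L μ) :
    ∃ W : α → ℝ, Integrable W μ ∧ (∀ x, 0 ≤ W x) ∧ ∀ n : ℕ, ∃ C : ℝ, ∀ x, n * L x - C ≤ W x := by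
  have hint : ∀ a : ℝ, 0 ≤ a → Integrable (fun x => max (L x - a) 0) μ := fun a ha =>
    hL.mono ((hL.1.sub aestronglyMeasurable_const).sup aestronglyMeasurable_const)
      (ae_of_all _ fun x => by
        rw [Real.norm_of_nonneg (le_max_right _ _), Real.norm_eq_abs]
        exact max_le (by linarith [le_abs_self (L x)]) (abs_nonneg _))
  have hlim : Tendsto (fun a : ℝ => ∫ x, max (L x - a) 0 ∂μ) atTop (nhds (∫ _, 0 ∂μ)) := by
    refine tendsto_integral_filter_of_dominated_convergence (fun x => ‖L x‖) ?_ ?_ hL.norm ?_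
    · filter_upwards [eventually_ge_atTop 0] with a ha using (hint a ha).1
    · filter_upwards [eventually_ge_atTop 0] with a ha
      refine ae_of_all _ fun x => ?_
      rw [Real.norm_of_nonneg (le_max_right _ _), Real.norm_eq_abs]
      exact max_le (by linarith [le_abs_self (L x)]) (abs_nonneg _)
    · refine ae_of_all _ fun x => tendsto_const_nhds.congr' ?_
      filter_upwards [eventually_ge_atTop (L x)] with a ha
      rw [max_eq_right (by linarith)]
  rw [integral_zero] at hlim
  have hex : ∀ k : ℕ, ∃ a : ℝ, (k : ℝ) ≤ a ∧ ∫ x, max (L x - a) 0 ∂μ ≤ (1 / 2) ^ k := fun k =>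
    ((eventually_ge_atTop (k : ℝ)).and (hlim.eventually_le_const (by positivity))).exists
  choose a hak ha using hex
  have ha0 : ∀ k, 0 ≤ a k := fun k => (Nat.cast_nonneg k).trans (hak k)
  set F : ℕ → α → ℝ := fun k x => max (L x - a k) 0 with hF
  have hF0 : ∀ k x, 0 ≤ F k x := fun k x => le_max_right _ _
  have hsupp : ∀ x, ∀ k ∉ Finset.range ⌈L x⌉₊, F k x = 0 := fun x k hk => by
    refine max_eq_right ?_
    have h1 : ⌈L x⌉₊ ≤ k := by simpa using hk
    have h2 : L x ≤ k := (Nat.le_ceil _).trans (by exact_mod_cast h1)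
    linarith [hak k]
  have hsum : ∀ x, Summable fun k => F k x := fun x =>
    summable_of_ne_finset_zero (s := Finset.range ⌈L x⌉₊) (hsupp x)
  refine ⟨fun x => ∑' k, F k x, ⟨?_, ?_⟩, fun x => tsum_nonneg fun k => hF0 k x, fun n =>
    ⟨∑ k ∈ Finset.range n, a k, fun x => ?_⟩⟩
  · refine aestronglyMeasurable_of_tendsto_ae atTop
      (f := fun n x => ∑ k ∈ Finset.range n, F k x) (fun n => ?_)
      (ae_of_all _ fun x => (hsum x).hasSum.tendsto_sum_nat)
    exact (integrable_finsetSum _ fun k _ => hint (a k) (ha0 k)).1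
  · have h1 : ∀ k, ∫⁻ x, ‖F k x‖ₑ ∂μ ≤ ENNReal.ofReal ((1 / 2) ^ k) := fun k => by
      rw [← ofReal_integral_norm_eq_lintegral_enorm (hint (a k) (ha0 k))]
      refine ENNReal.ofReal_le_ofReal ((le_of_eq ?_).trans (ha k))
      exact integral_congr_ae (ae_of_all _ fun x => Real.norm_of_nonneg (hF0 k x))
    calc ∫⁻ x, ‖∑' k, F k x‖ₑ ∂μ ≤ ∫⁻ x, ∑' k, ‖F k x‖ₑ ∂μ :=
        lintegral_mono fun x => enorm_tsum_le_tsum_enorm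
      _ = ∑' k, ∫⁻ x, ‖F k x‖ₑ ∂μ :=
        lintegral_tsum fun k => (hint (a k) (ha0 k)).1.enorm
      _ ≤ ∑' k : ℕ, ENNReal.ofReal ((1 / 2) ^ k) := ENNReal.tsum_le_tsum h1
      _ < ⊤ := summable_geometric_two.tsum_ofReal_lt_top
  · calc n * L x - ∑ k ∈ Finset.range n, a k = ∑ k ∈ Finset.range n, (L x - a k) := by
          simp [Finset.sum_sub_distrib]
      _ ≤ ∑ k ∈ Finset.range n, F k x := Finset.sum_le_sum fun k _ => le_max_left _ _
      _ ≤ _ := (hsum x).sum_le_tsum _ fun k _ => hF0 k x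

end DeLaValleePoussin

section VanishAllDeriv

theorem DifferentiableOn.iteratedDeriv {U : Set ℂ} (hU : IsOpen U) {F : ℂ → ℂ}
    (hF : DifferentiableOn ℂ F U) (k : ℕ) : DifferentiableOn ℂ (iteratedDeriv k F) U := by
  induction k with
  | zero => simpa using hF
  | succ k ih =>
    rw [iteratedDeriv_succ]
    exact ih.deriv hU

theorem vanishAllDeriv_indicator {K U : Set ℂ} (hK : K ⊆ sphere (0 : ℂ) 1) (hU : IsOpen U)
    (hKU : Disjoint U K) (hDU : closedBall (0 : ℂ) 1 \ K ⊆ U) {F : ℂ → ℂ}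
    (hF : DifferentiableOn ℂ F U)
    (hb : ∀ k, ∃ C : ℝ, ∀ z ∈ closedBall (0 : ℂ) 1 \ K,
      ‖iteratedDeriv k F z‖ ≤ C * infDist z K) :
    VanishAllDeriv K (Kᶜ.indicator F) := by
  have hball : ball (0 : ℂ) 1 ⊆ Kᶜ := fun z hz hzK => by
    have h1 := mem_sphere_zero_iff_norm.1 (hK hzK)
    have h2 := mem_ball_zero_iff.1 hz
    linarith
  have hzero : ∀ (G : ℂ → ℂ), ∀ z ∈ K, Kᶜ.indicator G z = 0 := fun G z hz =>
    indicator_of_notMem (by simpa using hz) _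
  have hcont : ∀ k, ContinuousOn (Kᶜ.indicator (iteratedDeriv k F)) (closedBall (0 : ℂ) 1) := by
    intro k z hz
    by_cases hzK : z ∈ K
    · obtain ⟨C, hC⟩ := hb k
      rw [ContinuousWithinAt, hzero _ z hzK]
      have hlim : Tendsto (fun w => C * infDist w K) (nhdsWithin z (closedBall (0 : ℂ) 1))
          (nhds 0) := by
        have h := ((continuous_infDist_pt K).tendsto z).const_mul C
        rw [infDist_zero_of_mem hzK, mul_zero] at h
        exact h.mono_left nhdsWithin_le_nhds
      refine squeeze_zero_norm' (eventually_of_mem self_mem_nhdsWithin fun w hw => ?_) hlim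
      by_cases hwK : w ∈ K
      · rw [hzero _ w hwK, infDist_zero_of_mem hwK, mul_zero, norm_zero]
      · rw [indicator_of_mem (by simpa using hwK)]
        exact hC w ⟨hw, hwK⟩
    · have hzU : z ∈ U := hDU ⟨hz, hzK⟩
      have h1 : ContinuousAt (iteratedDeriv k F) z :=
        ((hF.iteratedDeriv hU k).continuousOn).continuousAt (hU.mem_nhds hzU)
      refine (h1.congr ?_).continuousWithinAt
      filter_upwards [hU.mem_nhds hzU] with w hw
      exact (indicator_of_mem (s := Kᶜ) (fun h => hKU.notMem_of_mem_left hw h) _).symm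
  have heq : ∀ z ∈ ball (0 : ℂ) 1, Kᶜ.indicator F =ᶠ[nhds z] F := fun z hz => by
    filter_upwards [isOpen_ball.mem_nhds hz] with w hw using indicator_of_mem (hball hw) _
  refine ⟨by simpa using hcont 0, fun z hz => ?_, hzero F, fun n =>
    ⟨Kᶜ.indicator (iteratedDeriv n F), hcont n, fun z hz => ?_, hzero _⟩⟩
  · have hzU := hDU ⟨ball_subset_closedBall hz, hball hz⟩
    exact (((hF z hzU).differentiableAt (hU.mem_nhds hzU)).congr_of_eventuallyEq
      (heq z hz)).differentiableWithinAt
  · rw [indicator_of_mem (hball hz), (heq z hz).iteratedDeriv_eq]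

end VanishAllDeriv

section HerglotzIntegral

/-- The point of the ray through `e^{iθ}` pushed outside the unit disc by the distance from
`e^{iθ}` to `K`. -/
def outerPoint (K : Set ℂ) (θ : ℝ) : ℂ := (1 + infDist (exp (θ * I)) K : ℝ) * exp (θ * I)

/-- A Herglotz integral with poles moved outside the closed disc, except on `K`. -/
def herglotz (K : Set ℂ) (W : ℝ → ℝ) (z : ℂ) : ℂ :=
  ∫ θ in Ioc (-Real.pi) Real.pi,
    (W θ : ℂ) * ((outerPoint K θ + z) / (outerPoint K θ - z))

/-- A neighbourhood of the closed disc with `K` removed. -/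
def herglotzDomain (K : Set ℂ) : Set ℂ := {z | ‖z‖ < 1 + infDist z K / 4}

variable {K : Set ℂ}

theorem continuous_outerPoint : Continuous (outerPoint K) := by
  have : Continuous fun θ : ℝ => infDist (exp (θ * I)) K :=
    (continuous_infDist_pt K).comp (by fun_prop)
  unfold outerPoint
  fun_prop

theorem norm_outerPoint (θ : ℝ) : ‖outerPoint K θ‖ = 1 + infDist (exp (θ * I)) K := by
  have := infDist_nonneg (x := exp (θ * I)) (s := K)
  rw [outerPoint, norm_mul, norm_exp_ofReal_mul_I, mul_one, Complex.norm_of_nonneg (by linarith)]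

theorem norm_outerPoint_sub_exp (θ : ℝ) :
    ‖outerPoint K θ - exp (θ * I)‖ = infDist (exp (θ * I)) K := by
  have h : outerPoint K θ - exp (θ * I) = (infDist (exp (θ * I)) K : ℝ) * exp (θ * I) := by
    rw [outerPoint]; push_cast; ring
  rw [h, norm_mul, norm_exp_ofReal_mul_I, mul_one, Complex.norm_of_nonneg infDist_nonneg]

theorem isOpen_herglotzDomain : IsOpen (herglotzDomain K) :=
  isOpen_lt continuous_norm (continuous_const.add ((continuous_infDist_pt K).div_const 4))

theorem disjoint_herglotzDomain (hK : K ⊆ sphere (0 : ℂ) 1) : Disjoint (herglotzDomain K) K := by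
  rw [Set.disjoint_left]
  intro z hz hzK
  rw [herglotzDomain, mem_ofPred_eq, infDist_zero_of_mem hzK,
    mem_sphere_zero_iff_norm.1 (hK hzK)] at hz
  norm_num at hz

theorem infDist_pos_of_notMem (hK : IsClosed K) (hne : K.Nonempty) {z : ℂ} (hz : z ∉ K) :
    0 < infDist z K := (hK.notMem_iff_infDist_pos hne).1 hz

theorem subset_herglotzDomain (hK : IsClosed K) (hne : K.Nonempty) :
    closedBall (0 : ℂ) 1 \ K ⊆ herglotzDomain K := by
  intro z hz
  have h1 := infDist_pos_of_notMem hK hne hz.2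
  have h2 := mem_closedBall_zero_iff.1 hz.1
  rw [herglotzDomain, mem_ofPred_eq]
  linarith

theorem infDist_le_norm_outerPoint_sub {z : ℂ} (hz : z ∈ herglotzDomain K) (θ : ℝ) :
    infDist z K / 6 ≤ ‖outerPoint K θ - z‖ := by
  rw [herglotzDomain, mem_ofPred_eq] at hz
  have h1 := norm_sub_norm_le (outerPoint K θ) z
  rw [norm_outerPoint] at h1
  have h2 : infDist z K ≤ infDist (exp (θ * I)) K + dist z (exp (θ * I)) :=
    infDist_le_infDist_add_dist
  have h3 := dist_triangle z (outerPoint K θ) (exp (θ * I))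
  rw [dist_eq_norm (outerPoint K θ), norm_outerPoint_sub_exp, dist_comm z (outerPoint K θ),
    dist_eq_norm (outerPoint K θ)] at h3
  linarith

theorem infDist_le_two (hK : K ⊆ sphere (0 : ℂ) 1) (hne : K.Nonempty) {z : ℂ}
    (hz : z ∈ closedBall (0 : ℂ) 1) : infDist z K ≤ 2 := by
  obtain ⟨k, hk⟩ := hne
  refine (infDist_le_dist_of_mem hk).trans ?_
  have h1 := mem_sphere_zero_iff_norm.1 (hK hk)
  have h2 := mem_closedBall_zero_iff.1 hz
  have h3 := norm_sub_le z k
  rw [dist_eq_norm]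
  linarith

theorem exp_mem_closedBall (θ : ℝ) : exp (θ * I) ∈ closedBall (0 : ℂ) 1 := by
  rw [mem_closedBall_zero_iff, norm_exp_ofReal_mul_I]

theorem norm_outerPoint_le (hK : K ⊆ sphere (0 : ℂ) 1) (hne : K.Nonempty) (θ : ℝ) :
    ‖outerPoint K θ‖ ≤ 3 := by
  rw [norm_outerPoint]
  linarith [infDist_le_two hK hne (exp_mem_closedBall θ)]

theorem outerPoint_sub_ne_zero (hKc : IsClosed K) (hne : K.Nonempty)
    (hK : K ⊆ sphere (0 : ℂ) 1) {z : ℂ} (hz : z ∈ herglotzDomain K) (θ : ℝ) :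
    outerPoint K θ - z ≠ 0 := by
  have h1 := infDist_pos_of_notMem hKc hne ((disjoint_herglotzDomain hK).notMem_of_mem_left hz)
  have h2 := infDist_le_norm_outerPoint_sub hz θ
  exact norm_pos_iff.1 (by linarith)

variable {W : ℝ → ℝ}

theorem integrable_herglotz (hKc : IsClosed K) (hne : K.Nonempty) (hK : K ⊆ sphere (0 : ℂ) 1)
    (hW : IntegrableOn W (Ioc (-Real.pi) Real.pi)) {z : ℂ} (hz : z ∈ herglotzDomain K) :
    IntegrableOn (fun θ => (W θ : ℂ) * ((outerPoint K θ + z) / (outerPoint K θ - z)))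
      (Ioc (-Real.pi) Real.pi) := by
  have h1 := infDist_pos_of_notMem hKc hne ((disjoint_herglotzDomain hK).notMem_of_mem_left hz)
  have hc : Continuous fun θ => (outerPoint K θ + z) / (outerPoint K θ - z) :=
    (continuous_outerPoint.add_const z).div (continuous_outerPoint.sub continuous_const)
      (outerPoint_sub_ne_zero hKc hne hK hz)
  refine Integrable.mul_bdd (c := (3 + ‖z‖) / (infDist z K / 6)) hW.ofReal
    hc.aestronglyMeasurable (ae_of_all _ fun θ => ?_)
  rw [norm_div]
  gcongr
  · exact (norm_add_le _ _).trans (by linarith [norm_outerPoint_le hK hne θ])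
  · exact infDist_le_norm_outerPoint_sub hz θ

theorem differentiableOn_herglotz (hKc : IsClosed K) (hne : K.Nonempty)
    (hK : K ⊆ sphere (0 : ℂ) 1) (hW : IntegrableOn W (Ioc (-Real.pi) Real.pi)) :
    DifferentiableOn ℂ (herglotz K W) (herglotzDomain K) := by
  intro z hz
  have h1 := infDist_pos_of_notMem hKc hne ((disjoint_herglotzDomain hK).notMem_of_mem_left hz)
  set s : Set ℂ := herglotzDomain K ∩ {w | infDist z K / 2 < infDist w K} with hs
  have hs_mem : s ∈ nhds z :=
    (isOpen_herglotzDomain.inter (isOpen_lt continuous_const (continuous_infDist_pt K))).mem_nhds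
      ⟨hz, by rw [mem_ofPred_eq]; linarith⟩
  have hcF : ∀ w ∈ herglotzDomain K,
      Continuous fun θ => 2 * outerPoint K θ / (outerPoint K θ - w) ^ 2 := fun w hw =>
    (continuous_const.mul continuous_outerPoint).div
      ((continuous_outerPoint.sub continuous_const).pow 2)
      fun θ => pow_ne_zero 2 (outerPoint_sub_ne_zero hKc hne hK hw θ)
  refine (hasDerivAt_integral_of_dominated_loc_of_deriv_le
    (F := fun w θ => (W θ : ℂ) * ((outerPoint K θ + w) / (outerPoint K θ - w)))
    (F' := fun w θ => (W θ : ℂ) * (2 * outerPoint K θ / (outerPoint K θ - w) ^ 2))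
    (bound := fun θ => ‖W θ‖ * (2 * 3 / (infDist z K / 12) ^ 2)) hs_mem
    ?_ (integrable_herglotz hKc hne hK hW hz) ?_ ?_ (hW.norm.mul_const _)
    ?_).2.differentiableAt.differentiableWithinAt
  · filter_upwards [isOpen_herglotzDomain.mem_nhds hz] with w hw
      using (integrable_herglotz hKc hne hK hW hw).1
  · exact (hW.ofReal (𝕜 := ℂ)).1.mul (hcF z hz).aestronglyMeasurable
  · refine ae_of_all _ fun θ w hw => ?_
    have h2 := infDist_le_norm_outerPoint_sub hw.1 θ
    have h3 : infDist z K / 2 < infDist w K := hw.2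
    rw [norm_mul, norm_div, norm_mul, norm_pow, Complex.norm_real, Complex.norm_ofNat]
    gcongr
    · exact norm_outerPoint_le hK hne θ
    · linarith
  · refine ae_of_all _ fun θ w hw => ?_
    have h2 := outerPoint_sub_ne_zero hKc hne hK hw.1 θ
    have h3 := ((hasDerivAt_id w).const_add (outerPoint K θ)).div
      ((hasDerivAt_id w).const_sub (outerPoint K θ)) h2
    refine (h3.const_mul (W θ : ℂ)).congr_deriv ?_
    simp only [id]
    ring

theorem norm_herglotz_sub_le (hKc : IsClosed K) (hne : K.Nonempty) (hK : K ⊆ sphere (0 : ℂ) 1)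
    (hW : IntegrableOn W (Ioc (-Real.pi) Real.pi)) (hW0 : ∀ θ, 0 ≤ W θ) {z w : ℂ} {δ : ℝ}
    (hδ : 0 < δ) (hz : z ∈ herglotzDomain K) (hw : w ∈ herglotzDomain K) (hzδ : δ ≤ infDist z K)
    (hwδ : δ ≤ infDist w K) (hzw : ‖w - z‖ ≤ δ ^ 2) :
    ‖herglotz K W w - herglotz K W z‖ ≤ 216 * ∫ θ in Ioc (-Real.pi) Real.pi, W θ := by
  rw [herglotz, herglotz, ← integral_sub (integrable_herglotz hKc hne hK hW hw)
    (integrable_herglotz hKc hne hK hW hz), ← integral_const_mul]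
  refine norm_integral_le_of_norm_le (hW.const_mul _) (ae_of_all _ fun θ => ?_)
  have h1 := outerPoint_sub_ne_zero hKc hne hK hz θ
  have h2 := outerPoint_sub_ne_zero hKc hne hK hw θ
  have h3 := infDist_le_norm_outerPoint_sub hz θ
  have h4 := infDist_le_norm_outerPoint_sub hw θ
  have h5 : (W θ : ℂ) * ((outerPoint K θ + w) / (outerPoint K θ - w))
      - W θ * ((outerPoint K θ + z) / (outerPoint K θ - z))
      = W θ * (2 * outerPoint K θ * (w - z) / ((outerPoint K θ - w) * (outerPoint K θ - z))) := by
    field_simp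
    ring
  rw [h5, norm_mul, Complex.norm_of_nonneg (hW0 θ), mul_comm]
  refine mul_le_mul_of_nonneg_right ?_ (hW0 θ)
  rw [norm_div, norm_mul, norm_mul, norm_mul, Complex.norm_ofNat]
  calc 2 * ‖outerPoint K θ‖ * ‖w - z‖ / (‖outerPoint K θ - w‖ * ‖outerPoint K θ - z‖)
      ≤ 2 * 3 * δ ^ 2 / (δ / 6 * (δ / 6)) := by
        gcongr
        · exact norm_outerPoint_le hK hne θ
        · linarith
        · linarith
    _ = 216 := by field_simp; norm_num

end HerglotzIntegral

section HerglotzIntegral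

variable {K : Set ℂ} {W : ℝ → ℝ}

theorem re_add_div_sub (ζ z : ℂ) :
    ((ζ + z) / (ζ - z)).re = (‖ζ‖ ^ 2 - ‖z‖ ^ 2) / ‖ζ - z‖ ^ 2 := by
  rw [Complex.div_re, ← add_div, Complex.sq_norm, Complex.sq_norm, Complex.sq_norm, normSq_apply ζ,
    normSq_apply z]
  congr 1
  simp only [add_re, sub_re, add_im, sub_im]
  ring

theorem re_herglotz (hKc : IsClosed K) (hne : K.Nonempty) (hK : K ⊆ sphere (0 : ℂ) 1)
    (hW : IntegrableOn W (Ioc (-Real.pi) Real.pi)) {z : ℂ} (hz : z ∈ herglotzDomain K) :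
    IntegrableOn (fun θ => W θ * ((‖outerPoint K θ‖ ^ 2 - ‖z‖ ^ 2) / ‖outerPoint K θ - z‖ ^ 2))
      (Ioc (-Real.pi) Real.pi) ∧
    (herglotz K W z).re = ∫ θ in Ioc (-Real.pi) Real.pi,
      W θ * ((‖outerPoint K θ‖ ^ 2 - ‖z‖ ^ 2) / ‖outerPoint K θ - z‖ ^ 2) := by
  have h := integrable_herglotz hKc hne hK hW hz
  have h2 := reCLM.integral_comp_comm h
  have h3 := h.re
  simp only [reCLM_apply, re_ofReal_mul, re_add_div_sub, RCLike.re_eq_complex_re] at h2 h3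
  exact ⟨h3, h2.symm⟩

theorem herglotz_kernel_nonneg {z : ℂ} (hz : z ∈ closedBall (0 : ℂ) 1) (θ : ℝ) :
    0 ≤ (‖outerPoint K θ‖ ^ 2 - ‖z‖ ^ 2) / ‖outerPoint K θ - z‖ ^ 2 := by
  have h1 := mem_closedBall_zero_iff.1 hz
  have h2 := infDist_nonneg (x := exp (θ * I)) (s := K)
  have h3 := norm_outerPoint (K := K) θ
  have h4 := norm_nonneg z
  refine div_nonneg ?_ (sq_nonneg _)
  nlinarith

theorem re_herglotz_nonneg (hKc : IsClosed K) (hne : K.Nonempty) (hK : K ⊆ sphere (0 : ℂ) 1)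
    (hW : IntegrableOn W (Ioc (-Real.pi) Real.pi)) (hW0 : ∀ θ, 0 ≤ W θ) {z : ℂ}
    (hz : z ∈ closedBall (0 : ℂ) 1 \ K) : 0 ≤ (herglotz K W z).re := by
  rw [(re_herglotz hKc hne hK hW (subset_herglotzDomain hKc hne hz)).2]
  exact integral_nonneg fun θ => mul_nonneg (hW0 θ) (herglotz_kernel_nonneg hz.1 θ)

theorem norm_exp_mul_I_sub_le (θ α : ℝ) : ‖exp (θ * I) - exp (α * I)‖ ≤ |θ - α| := by
  have h : exp (θ * I) - exp (α * I) = exp (α * I) * (exp (I * (θ - α : ℝ)) - 1) := by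
    rw [mul_sub, ← exp_add, mul_one]
    congr 2
    push_cast
    ring
  rw [h, norm_mul, norm_exp_ofReal_mul_I, one_mul]
  exact Real.norm_exp_I_mul_ofReal_sub_one_le

theorem one_sub_norm_le_infDist (hne : K.Nonempty) (hK : K ⊆ sphere (0 : ℂ) 1) (z : ℂ) :
    1 - ‖z‖ ≤ infDist z K := by
  rw [le_infDist hne]
  intro k hk
  have h1 := mem_sphere_zero_iff_norm.1 (hK hk)
  rw [← h1, dist_eq_norm, norm_sub_rev]
  exact norm_sub_norm_le k z

theorem herglotz_kernel_ge (hKc : IsClosed K) (hne : K.Nonempty) (hK : K ⊆ sphere (0 : ℂ) 1)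
    {z : ℂ} (hz : z ∈ closedBall (0 : ℂ) 1 \ K) {θ : ℝ} (hθ : |θ - arg z| ≤ infDist z K / 4) :
    infDist (exp (θ * I)) K ≤ 9 * infDist z K / 4 ∧
    1 / (17 * infDist z K) ≤
      (‖outerPoint K θ‖ ^ 2 - ‖z‖ ^ 2) / ‖outerPoint K θ - z‖ ^ 2 := by
  have hδ := infDist_pos_of_notMem hKc hne hz.2
  have hr := mem_closedBall_zero_iff.1 hz.1
  have hr1 := one_sub_norm_le_infDist hne hK z
  have h1 : ‖exp (arg z * I) - z‖ = 1 - ‖z‖ := by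
    have h : exp (arg z * I) - z = ((1 - ‖z‖ : ℝ) : ℂ) * exp (arg z * I) := by
      push_cast
      linear_combination norm_mul_exp_arg_mul_I z
    rw [h, norm_mul, norm_exp_ofReal_mul_I, mul_one, Complex.norm_of_nonneg (by linarith)]
  have h2 : ‖exp (θ * I) - z‖ ≤ infDist z K / 4 + (1 - ‖z‖) := by
    rw [← sub_add_sub_cancel _ (exp (arg z * I)), ← h1]
    exact (norm_add_le _ _).trans
      (add_le_add_left ((norm_exp_mul_I_sub_le θ (arg z)).trans hθ) _)
  have h3 : infDist (exp (θ * I)) K ≤ infDist z K + dist (exp (θ * I)) z :=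
    infDist_le_infDist_add_dist
  have h4 : infDist z K ≤ infDist (exp (θ * I)) K + dist z (exp (θ * I)) :=
    infDist_le_infDist_add_dist
  rw [dist_comm] at h4
  rw [dist_eq_norm] at h3 h4
  have h5 : ‖outerPoint K θ - z‖ ≤ infDist (exp (θ * I)) K + ‖exp (θ * I) - z‖ := by
    rw [← norm_outerPoint_sub_exp (K := K) θ, ← sub_add_sub_cancel _ (exp (θ * I))]
    exact norm_add_le _ _
  have h6 := infDist_le_norm_outerPoint_sub (subset_herglotzDomain hKc hne hz) θ
  refine ⟨by linarith, ?_⟩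
  rw [norm_outerPoint]
  have hnum : 3 * infDist z K / 4 ≤ (1 + infDist (exp (θ * I)) K) ^ 2 - ‖z‖ ^ 2 := by
    nlinarith [norm_nonneg z, infDist_nonneg (x := exp (θ * I)) (s := K)]
  have hden : ‖outerPoint K θ - z‖ ^ 2 ≤ (7 * infDist z K / 2) ^ 2 := by
    gcongr
    linarith
  rw [div_le_div_iff₀ (by positivity) (pow_pos (by linarith) 2)]
  nlinarith

theorem exists_Ioc_subset {δ α : ℝ} (hδ : 0 < δ) (hδ2 : δ ≤ 2)
    (hα : α ∈ Ioc (-Real.pi) Real.pi) :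
    ∃ a : ℝ, Ioc a (a + δ / 4) ⊆ Ioc (-Real.pi) Real.pi ∧
      ∀ θ ∈ Ioc a (a + δ / 4), |θ - α| ≤ δ / 4 := by
  have hpi := Real.pi_gt_three
  rcases le_or_gt α 0 with h | h
  · refine ⟨α, fun θ hθ => ⟨hα.1.trans hθ.1, by linarith [hθ.2]⟩, fun θ hθ => ?_⟩
    rw [abs_le]; constructor <;> linarith [hθ.1, hθ.2]
  · refine ⟨α - δ / 4, fun θ hθ => ⟨by linarith [hθ.1], by linarith [hθ.2, hα.2]⟩, fun θ hθ => ?_⟩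
    rw [abs_le]; constructor <;> linarith [hθ.1, hθ.2]

theorem le_re_herglotz (hKc : IsClosed K) (hne : K.Nonempty) (hK : K ⊆ sphere (0 : ℂ) 1)
    (hnull : ∀ᵐ θ : ℝ ∂volume.restrict (Ioc (-Real.pi) Real.pi), exp (θ * I) ∉ K)
    (hW : IntegrableOn W (Ioc (-Real.pi) Real.pi)) (hW0 : ∀ θ, 0 ≤ W θ) {A C : ℝ} (hA : 0 ≤ A)
    (hAW : ∀ θ : ℝ, A * Real.log (2 / infDist (exp (θ * I)) K) - C ≤ W θ) {z : ℂ}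
    (hz : z ∈ closedBall (0 : ℂ) 1 \ K) :
    (A * Real.log (8 / (9 * infDist z K)) - C) / 68 ≤ (herglotz K W z).re := by
  set δ := infDist z K with hδdef
  set c := A * Real.log (8 / (9 * δ)) - C with hc
  have hδ : 0 < δ := infDist_pos_of_notMem hKc hne hz.2
  rcases le_or_gt c 0 with hc0 | hc0
  · exact (div_nonpos_of_nonpos_of_nonneg hc0 (by norm_num)).trans
      (re_herglotz_nonneg hKc hne hK hW hW0 hz)
  obtain ⟨a, hsub, habs⟩ := exists_Ioc_subset hδ (infDist_le_two hK hne hz.1)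
    (arg_mem_Ioc z)
  obtain ⟨hint, heq⟩ := re_herglotz hKc hne hK hW (subset_herglotzDomain hKc hne hz)
  rw [heq]
  have h1 : ∫ _ in Ioc a (a + δ / 4), c * (1 / (17 * δ)) = c / 68 := by
    rw [setIntegral_const, measureReal_def, Real.volume_Ioc, smul_eq_mul,
      ENNReal.toReal_ofReal (by linarith)]
    field_simp
    ring
  rw [← h1]
  refine le_trans ?_ (setIntegral_mono_set hint (ae_of_all _ fun θ =>
    mul_nonneg (hW0 θ) (herglotz_kernel_nonneg hz.1 θ)) hsub.eventuallyLE)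
  refine setIntegral_mono_ae_restrict (integrableOn_const (by simp)) (hint.mono_set hsub) ?_
  filter_upwards [ae_restrict_of_ae_restrict_of_subset hsub hnull,
    ae_restrict_mem measurableSet_Ioc] with θ hθK hθ
  obtain ⟨h2, h3⟩ := herglotz_kernel_ge hKc hne hK hz (habs θ hθ)
  have h4 := infDist_pos_of_notMem hKc hne hθK
  have h5 : c ≤ W θ := by
    refine le_trans ?_ (hAW θ)
    rw [hc]
    have h6 : Real.log (8 / (9 * δ)) ≤ Real.log (2 / infDist (exp (θ * I)) K) := by
      refine Real.log_le_log (by positivity) ?_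
      rw [div_le_div_iff₀ (by positivity) h4]
      linarith
    linarith [mul_le_mul_of_nonneg_left h6 hA]
  exact mul_le_mul h5 h3 (by positivity) (hW0 θ)

end HerglotzIntegral

section OuterFunction

variable {K : Set ℂ} {W : ℝ → ℝ}

theorem exp_neg_re_herglotz_le (hKc : IsClosed K) (hne : K.Nonempty)
    (hK : K ⊆ sphere (0 : ℂ) 1)
    (hnull : ∀ᵐ θ : ℝ ∂volume.restrict (Ioc (-Real.pi) Real.pi), exp (θ * I) ∉ K)
    (hW : IntegrableOn W (Ioc (-Real.pi) Real.pi)) (hW0 : ∀ θ, 0 ≤ W θ)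
    (hAW : ∀ n : ℕ, ∃ C : ℝ, ∀ θ : ℝ,
      n * Real.log (2 / infDist (exp (θ * I)) K) - C ≤ W θ) {s : ℝ} (hs : 0 < s) (M : ℕ) :
    ∃ C : ℝ, 0 ≤ C ∧ ∀ z ∈ closedBall (0 : ℂ) 1 \ K,
      Real.exp (-(s * (herglotz K W z).re)) ≤ C * infDist z K ^ M := by
  obtain ⟨n, hn⟩ := exists_nat_ge (68 * M / s)
  rw [div_le_iff₀ hs] at hn
  obtain ⟨C, hC⟩ := hAW n
  refine ⟨Real.exp (n * s / 68 - M + s * C / 68 - M * Real.log (8 / 9)), (Real.exp_pos _).le,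
    fun z hz => ?_⟩
  have hδ : 0 < infDist z K := infDist_pos_of_notMem hKc hne hz.2
  have hδ2 := infDist_le_two hK hne hz.1
  have h1 := le_re_herglotz hKc hne hK hnull hW hW0 (Nat.cast_nonneg n) hC hz
  have h2 : Real.log (8 / (9 * infDist z K)) = Real.log (8 / 9) - Real.log (infDist z K) := by
    rw [← Real.log_div (by norm_num) hδ.ne', div_div]
  have h3 : -1 ≤ Real.log (8 / (9 * infDist z K)) := by
    rw [Real.le_log_iff_exp_le (by positivity), Real.exp_neg, le_div_iff₀ (by positivity),
      inv_mul_le_iff₀ (Real.exp_pos _)]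
    linarith [Real.exp_one_gt_d9]
  rw [← Real.rpow_natCast, Real.rpow_def_of_pos hδ, ← Real.exp_add, Real.exp_le_exp]
  have h4 : 0 ≤ (n * s / 68 - M) * (Real.log (8 / (9 * infDist z K)) + 1) :=
    mul_nonneg (by linarith) (by linarith)
  have h5 := mul_le_mul_of_nonneg_left h1 hs.le
  rw [h2] at h4 h5
  nlinarith

/-- A disc around `z` of radius comparable to the squared distance to `K`. -/
theorem closedBall_subset_herglotzDomain {z w : ℂ} (hz : z ∈ closedBall (0 : ℂ) 1)
    (hδ : 0 < infDist z K) (hδ2 : infDist z K ≤ 2)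
    (hw : w ∈ closedBall z (infDist z K ^ 2 / 32)) :
    w ∈ herglotzDomain K ∧ infDist z K / 2 ≤ infDist w K ∧
      ‖w - z‖ ≤ (infDist z K / 2) ^ 2 := by
  have h1 : ‖w - z‖ ≤ infDist z K ^ 2 / 32 := by rwa [mem_closedBall, dist_eq_norm] at hw
  have h2 : infDist z K ≤ infDist w K + dist z w := infDist_le_infDist_add_dist
  rw [dist_comm, dist_eq_norm] at h2
  have h3 := norm_sub_norm_le w z
  have h4 := mem_closedBall_zero_iff.1 hz
  refine ⟨?_, by nlinarith, by nlinarith⟩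
  rw [herglotzDomain, mem_ofPred_eq]
  nlinarith

theorem vanishAllDeriv_exp_herglotz (hKc : IsClosed K) (hne : K.Nonempty)
    (hK : K ⊆ sphere (0 : ℂ) 1)
    (hnull : ∀ᵐ θ : ℝ ∂volume.restrict (Ioc (-Real.pi) Real.pi), exp (θ * I) ∉ K)
    (hW : IntegrableOn W (Ioc (-Real.pi) Real.pi)) (hW0 : ∀ θ, 0 ≤ W θ)
    (hAW : ∀ n : ℕ, ∃ C : ℝ, ∀ θ : ℝ,
      n * Real.log (2 / infDist (exp (θ * I)) K) - C ≤ W θ) {s : ℝ} (hs : 0 < s) :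
    VanishAllDeriv K (Kᶜ.indicator fun z => exp (-(s * herglotz K W z))) := by
  have hF : DifferentiableOn ℂ (fun z => exp (-(s * herglotz K W z))) (herglotzDomain K) :=
    (((differentiableOn_herglotz hKc hne hK hW).const_mul (s : ℂ)).neg).cexp
  have hnorm : ∀ z, ‖exp (-(s * herglotz K W z))‖ = Real.exp (-(s * (herglotz K W z).re)) :=
    fun z => by rw [norm_exp, neg_re, re_ofReal_mul]
  refine vanishAllDeriv_indicator hK isOpen_herglotzDomain (disjoint_herglotzDomain hK)
    (subset_herglotzDomain hKc hne) hF fun k => ?_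
  obtain ⟨C, hC0, hC⟩ := exp_neg_re_herglotz_le hKc hne hK hnull hW hW0 hAW hs (2 * k + 1)
  set D : ℝ := Real.exp (s * (216 * ∫ θ in Ioc (-Real.pi) Real.pi, W θ))
  refine ⟨k.factorial * (D * C) * 32 ^ k, fun z hz => ?_⟩
  have hδ : 0 < infDist z K := infDist_pos_of_notMem hKc hne hz.2
  have hsub := fun w => closedBall_subset_herglotzDomain (w := w) hz.1 hδ
    (infDist_le_two hK hne hz.1)
  have hR : 0 < infDist z K ^ 2 / 32 := by positivity
  have hdiff : DiffContOnCl ℂ (fun z => exp (-(s * herglotz K W z)))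
      (ball z (infDist z K ^ 2 / 32)) :=
    DifferentiableOn.diffContOnCl (hF.mono (closure_ball_subset_closedBall.trans
      fun w hw => (hsub w hw).1))
  have hbound : ∀ w ∈ sphere z (infDist z K ^ 2 / 32),
      ‖exp (-(s * herglotz K W w))‖ ≤ D * (C * infDist z K ^ (2 * k + 1)) := by
    intro w hw
    obtain ⟨h1, h2, h3⟩ := hsub w (sphere_subset_closedBall hw)
    have h4 := norm_herglotz_sub_le hKc hne hK hW hW0 (half_pos hδ)
      (subset_herglotzDomain hKc hne hz) h1 (by linarith) h2 h3
    have h5 := (Complex.abs_re_le_norm _).trans h4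
    rw [sub_re, abs_le] at h5
    refine le_trans ?_ (mul_le_mul_of_nonneg_left (hC z hz) (Real.exp_pos _).le)
    rw [hnorm, ← Real.exp_add, Real.exp_le_exp]
    nlinarith [h5.1]
  refine (norm_iteratedDeriv_le_of_forall_mem_sphere_norm_le k hR hdiff hbound).trans
    (le_of_eq ?_)
  rw [pow_succ, pow_mul, div_pow]
  field_simp

/-- A Carleson Kronecker set is the zero set of an outer function all of whose positive powers
are smooth up to the boundary and flat on the set. -/
theorem exists_outer_vanishAllDeriv (hK1 : IsKronecker K) (hK2 : IsCarleson K) :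
    ∃ H : ℂ → ℂ, (∀ z ∈ ball (0 : ℂ) 1, 0 ≤ (H z).re) ∧
      ∀ s : ℝ, 0 < s → VanishAllDeriv K (Kᶜ.indicator fun z => exp (-(s * H z))) := by
  obtain ⟨hKc, hK, hL⟩ := hK2
  rcases K.eq_empty_or_nonempty with rfl | hne
  · refine ⟨0, fun _ _ => le_rfl, fun s _ => ?_⟩
    have h : ((∅ : Set ℂ)ᶜ.indicator fun z => exp (-(s * (0 : ℂ → ℂ) z))) = fun _ => 1 := by
      ext z
      simp
    rw [h]
    refine ⟨continuousOn_const, differentiableOn_const _, fun z hz => hz.elim, fun n =>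
      ⟨iteratedDeriv n fun _ => 1, ?_, fun _ _ => rfl, fun z hz => hz.elim⟩⟩
    exact (contDiff_const.continuous_iteratedDeriv n le_top).continuousOn
  · obtain ⟨W, hW, hW0, hAW⟩ := exists_integrable_superlinear hL
    refine ⟨herglotz K W, fun z hz => ?_, fun s hs =>
      vanishAllDeriv_exp_herglotz hKc hne hK hK1.ae_notMem hW hW0 hAW hs⟩
    refine re_herglotz_nonneg hKc hne hK hW hW0 ⟨ball_subset_closedBall hz, fun hzK => ?_⟩
    have h1 := hK1.norm_eq_one hzK
    have h2 := mem_ball_zero_iff.1 hz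
    linarith

end OuterFunction

/-- If `K` is both a Kronecker set and a Carleson set, then `J₀⁺(K)` has
trivial inner factor (`S_{J₀⁺(K)} = 1`), and the closed ideal it generates in `A(Γ)` is
exactly the set of functions of `A(Γ)` vanishing on `K`. -/
theorem stmt_11 (K : Set ℂ) (hK1 : IsKronecker K) (hK2 : IsCarleson K) :
    IsGcdInner (J0Plus K) (fun _ => 1) ∧
    IdealGenW (J0Plus K) = {f ∈ WienerAlg | ∀ z ∈ K, f z = 0} := by
  have hK := hK2.2.1
  obtain ⟨H, hH0, hH⟩ := exists_outer_vanishAllDeriv hK1 hK2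
  have hball : ∀ z ∈ ball (0 : ℂ) 1, z ∈ Kᶜ := fun z hz hzK =>
    (mem_ball_zero_iff.1 hz).ne (mem_sphere_zero_iff_norm.1 (hK hzK))
  have hnorm : ∀ (s : ℝ), ∀ z ∈ ball (0 : ℂ) 1,
      ‖Kᶜ.indicator (fun z => exp (-(s * H z))) z‖ = Real.exp (-(s * (H z).re)) :=
    fun s z hz => by rw [indicator_of_mem (hball z hz), norm_exp, neg_re, re_ofReal_mul]
  refine ⟨isGcdInner_one (fun f hf => APlus.mem_hinf hf.1) fun ε hε => ?_,
    Subset.antisymm (fun f hf => ?_) fun f hf => mem_sInter.2 fun J ⟨hJ, hsub⟩ => ?_⟩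
  · have h0 := hH0 0 (mem_ball_self one_pos)
    have hs : 0 < ε / ((H 0).re + 1) := by positivity
    refine ⟨_, (hH _ hs).mem_j0Plus, fun z hz => ?_, ?_⟩
    · rw [hnorm _ z hz, Real.exp_le_one_iff, neg_nonpos]
      exact mul_nonneg hs.le (hH0 z hz)
    · rw [hnorm _ 0 (mem_ball_self one_pos)]
      refine lt_of_lt_of_le ?_ (Real.one_sub_le_exp_neg _)
      have h1 : ε / ((H 0).re + 1) * ((H 0).re + 1) = ε := div_mul_cancel₀ _ (by positivity)
      linarith
  · exact mem_sInter.1 hf _ ⟨isClosedIdealW_setOf_eq_zero hK, fun g hg =>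
      ⟨APlus.mem_wienerAlg hg.1, fun z hz => J0Plus.eq_zero hK hg hz⟩⟩
  · have hF := hsub (hH 1 one_pos).mem_j0Plus
    refine mem_of_isClosedIdealW hK1 hJ ⟨_, hF⟩ (fun w _ hwK => ⟨_, hF, ?_⟩) hf.1 hf.2
    rw [indicator_of_mem hwK]
    exact exp_ne_zero _
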